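/- arXiv:2011.12496 — 4 statements merged into one kernel-verified Lean document; each statement's English description precedes it below -/
import Mathlib

section
/- Under the stated setup, let 𝒞 be a connected component of G[S] that contains no linked D-pairs. Then 𝒞 contains no D-pair S_u such that u has exactly one neighbor in A, exactly one neighbor in B, and exactly one neighbor in D. -/
open Finset

/-- `m` encodes a perfect matching of the induced subgraph `G[S]`:
every vertex of `S` is matched to a distinct adjacent vertex of `S`. -/
def IsMatchingOn {V : Type*} (G : SimpleGraph V) (S : Finset V) (m : V → V) : Prop :=
  ∀ u ∈ S, m u ∈ S ∧ m u ≠ u ∧ G.Adj u (m u) ∧ m (m u) = u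

/-- `S` is a paired dominating set of `G`: a dominating set such that `G[S]`
has a perfect matching. -/
def IsPDS {V : Type*} (G : SimpleGraph V) (S : Finset V) : Prop :=
  (∀ v : V, v ∉ S → ∃ u ∈ S, G.Adj v u) ∧ ∃ m : V → V, IsMatchingOn G S m

/-- The paired domination number of `G`. -/
noncomputable def gammaPr {V : Type*} (G : SimpleGraph V) : ℕ :=
  sInf {k : ℕ | ∃ S : Finset V, IsPDS G S ∧ S.card = k}

/-- `N_S(x)`, the set of neighbours of `x` inside `S`. -/
def nbrS {V : Type*} [DecidableEq V] (G : SimpleGraph V) [DecidableRel G.Adj]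
    (S : Finset V) (x : V) : Finset V :=
  S.filter (fun u => G.Adj x u)

/-- `λ(S)`: (twice) the number of edges of `G[S]` (each edge counted in both directions). -/
def lambdaS {V : Type*} [DecidableEq V] (G : SimpleGraph V) [DecidableRel G.Adj]
    (S : Finset V) : ℕ :=
  ((S ×ˢ S).filter (fun p => G.Adj p.1 p.2)).card

/-- The private neighbours of `u ∈ S`: vertices outside `S` whose unique
neighbour in `S` is `u`. -/
def privates {V : Type*} [Fintype V] [DecidableEq V] (G : SimpleGraph V) [DecidableRel G.Adj]
    (S : Finset V) (u : V) : Finset V :=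
  Finset.univ.filter (fun x => x ∉ S ∧ nbrS G S x = {u})

/-- `A = {v ∈ S : v and v̄ together have at least two private neighbours}`. -/
def setA {V : Type*} [Fintype V] [DecidableEq V] (G : SimpleGraph V) [DecidableRel G.Adj]
    (S : Finset V) (m : V → V) : Finset V :=
  S.filter (fun v => 2 ≤ (privates G S v).card + (privates G S (m v)).card)

/-- `B = {v ∈ S : v has a private neighbour and v̄ has none}`. -/
def setB {V : Type*} [Fintype V] [DecidableEq V] (G : SimpleGraph V) [DecidableRel G.Adj]
    (S : Finset V) (m : V → V) : Finset V :=
  S.filter (fun v => (privates G S v).Nonempty ∧ privates G S (m v) = ∅)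

/-- `C = {v ∈ S : v̄ ∈ B}`. -/
def setC {V : Type*} [Fintype V] [DecidableEq V] (G : SimpleGraph V) [DecidableRel G.Adj]
    (S : Finset V) (m : V → V) : Finset V :=
  S.filter (fun v => m v ∈ setB G S m)

/-- `D = {v ∈ S : neither v nor v̄ has a private neighbour}`. -/
def setD {V : Type*} [Fintype V] [DecidableEq V] (G : SimpleGraph V) [DecidableRel G.Adj]
    (S : Finset V) (m : V → V) : Finset V :=
  S.filter (fun v => privates G S v = ∅ ∧ privates G S (m v) = ∅)

/-- The weight `f(xu)` of an edge `xu` with `x ∈ V∖S` and `u ∈ S`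
(`0` on non-edges and on pairs not of this form). -/
def fwt {V : Type*} [Fintype V] [DecidableEq V] (G : SimpleGraph V) [DecidableRel G.Adj]
    (S : Finset V) (m : V → V) (x u : V) : ℚ :=
  if x ∈ S ∨ u ∉ S ∨ ¬ G.Adj x u then 0
  else if nbrS G S x = {u} then 1
  else if nbrS G S x ⊆ setA G S m ∨ nbrS G S x ⊆ setB G S m ∪ setC G S m ∨
      nbrS G S x ⊆ setD G S m then
    1 / ((nbrS G S x).card : ℚ)
  else if u ∈ setA G S m then 0
  else if nbrS G S x ∩ setD G S m = ∅ then
    1 / (((nbrS G S x ∩ (setB G S m ∪ setC G S m))).card : ℚ)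
  else if u ∈ setB G S m ∪ setC G S m then 1 / 6
  else (1 - ((nbrS G S x ∩ (setB G S m ∪ setC G S m)).card : ℚ) / 6) /
      ((nbrS G S x ∩ setD G S m).card : ℚ)

/-- `f(S')`: total weight of the edges between `S' ⊆ S` and `V∖S`. -/
def fsum {V : Type*} [Fintype V] [DecidableEq V] (G : SimpleGraph V) [DecidableRel G.Adj]
    (S : Finset V) (m : V → V) (T : Finset V) : ℚ :=
  ∑ u ∈ T, ∑ x ∈ Finset.univ \ S, fwt G S m x u

/-- `C` is (the vertex set of) a connected component of `G[S]`. -/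
def IsComponent {V : Type*} [DecidableEq V] (G : SimpleGraph V) [DecidableRel G.Adj]
    (S C : Finset V) : Prop :=
  C ⊆ S ∧ C.Nonempty ∧ (G.induce (↑C : Set V)).Connected ∧
    ∀ u ∈ C, ∀ v ∈ S, G.Adj u v → v ∈ C

/-- `S_u = {u, m u}` is a `D`-pair. -/
def IsDPair {V : Type*} [Fintype V] [DecidableEq V] (G : SimpleGraph V) [DecidableRel G.Adj]
    (S : Finset V) (m : V → V) (u : V) : Prop :=
  u ∈ setD G S m ∧ m u ∈ setD G S m

/-- `S_u = {u, m u}` is an `A`-pair. -/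
def IsAPair {V : Type*} [Fintype V] [DecidableEq V] (G : SimpleGraph V) [DecidableRel G.Adj]
    (S : Finset V) (m : V → V) (u : V) : Prop :=
  u ∈ setA G S m ∧ m u ∈ setA G S m

/-- `S_u = {u, m u}` is a `BC`-pair. -/
def IsBCPair {V : Type*} [Fintype V] [DecidableEq V] (G : SimpleGraph V) [DecidableRel G.Adj]
    (S : Finset V) (m : V → V) (u : V) : Prop :=
  (u ∈ setB G S m ∧ m u ∈ setC G S m) ∨ (u ∈ setC G S m ∧ m u ∈ setB G S m)

/-- `u` is a leaf of `G[S]`: it has exactly one neighbour in `S`. -/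
def IsLeaf {V : Type*} [DecidableEq V] (G : SimpleGraph V) [DecidableRel G.Adj]
    (S : Finset V) (u : V) : Prop :=
  (nbrS G S u).card = 1

/-- `S_u` is a solo pair: both `u` and `m u` are leaves of `G[S]`. -/
def IsSoloPair {V : Type*} [DecidableEq V] (G : SimpleGraph V) [DecidableRel G.Adj]
    (S : Finset V) (m : V → V) (u : V) : Prop :=
  IsLeaf G S u ∧ IsLeaf G S (m u)

/-- The component `C` of `G[S]` contains no linked `D`-pairs: no edge of `G[S]`
joins vertices of two distinct `D`-pairs. -/
def NoLinkedDPairs {V : Type*} [Fintype V] [DecidableEq V] (G : SimpleGraph V)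
    [DecidableRel G.Adj] (S : Finset V) (m : V → V) (C : Finset V) : Prop :=
  ∀ u ∈ C, ∀ v ∈ C, u ∈ setD G S m → v ∈ setD G S m → v ≠ u → v ≠ m u → ¬ G.Adj u v

/-- `{w₁, w₂}` is a constraint pair of the solo `D`-pair `S_u`. -/
def ConstraintPair {V : Type*} [Fintype V] [DecidableEq V] (G : SimpleGraph V)
    [DecidableRel G.Adj] (S : Finset V) (m : V → V) (u w₁ w₂ : V) : Prop :=
  ∃ x y : V, x ∉ S ∧ y ∉ S ∧ G.Adj u y ∧ G.Adj (m u) x ∧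
    G.Adj x w₁ ∧ G.Adj y w₂ ∧ w₁ ∈ setD G S m ∧ w₂ ∈ setD G S m ∧
    w₁ ≠ w₂ ∧ m w₁ ≠ w₂

/-- The pairs `S_u` and `S_v` are adjacent: some vertex of one is adjacent
to some vertex of the other. -/
def PairAdj {V : Type*} (G : SimpleGraph V) (m : V → V) (u v : V) : Prop :=
  G.Adj u v ∨ G.Adj u (m v) ∨ G.Adj (m u) v ∨ G.Adj (m u) (m v)

/-- The Petersen graph, as the Kneser graph on 2-element subsets of a
5-element set, two subsets being adjacent iff they are disjoint. -/
def petersenGraph : SimpleGraph {s : Finset (Fin 5) // s.card = 2} where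
  Adj a b := Disjoint (a : Finset (Fin 5)) (b : Finset (Fin 5))
  symm := ⟨fun _ _ h => h.symm⟩
  loopless := by
    constructor
    intro a h
    rw [disjoint_self] at h
    have h2 := a.2
    rw [h] at h2
    simp at h2


/-- Adding a vertex `x` to `R` adds twice its number of neighbours in `R`. -/
theorem lambdaS_insert {V : Type*} [DecidableEq V] (G : SimpleGraph V) [DecidableRel G.Adj]
    (R : Finset V) (x : V) (hx : x ∉ R) :
    lambdaS G (insert x R) = lambdaS G R + 2 * (nbrS G R x).card := by
  unfold lambdaS nbrS
  have h : ((insert x R ×ˢ insert x R).filter (fun p => G.Adj p.1 p.2)) =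
      ((R ×ˢ R).filter (fun p => G.Adj p.1 p.2)) ∪
      ((R.filter (fun u => G.Adj x u)).image (fun u => (x, u)) ∪
       (R.filter (fun u => G.Adj x u)).image (fun u => (u, x))) := by
    ext ⟨a, b⟩
    simp only [mem_filter, mem_product, mem_insert, mem_union, mem_image, Prod.mk.injEq]
    constructor
    · rintro ⟨⟨rfl | ha, rfl | hb⟩, hab⟩
      · exact absurd hab G.irrefl
      · exact Or.inr (Or.inl ⟨b, ⟨hb, hab⟩, rfl, rfl⟩)
      · exact Or.inr (Or.inr ⟨a, ⟨ha, hab.symm⟩, rfl, rfl⟩)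
      · exact Or.inl ⟨⟨ha, hb⟩, hab⟩
    · rintro (⟨⟨ha, hb⟩, hab⟩ | ⟨w, ⟨hw, hab⟩, rfl, rfl⟩ | ⟨w, ⟨hw, hab⟩, rfl, rfl⟩)
      · exact ⟨⟨Or.inr ha, Or.inr hb⟩, hab⟩
      · exact ⟨⟨Or.inl rfl, Or.inr hw⟩, hab⟩
      · exact ⟨⟨Or.inr hw, Or.inl rfl⟩, hab.symm⟩
  rw [h, card_union_of_disjoint, card_union_of_disjoint, card_image_of_injective,
    card_image_of_injective]
  · ring
  · intro a b hab; simpa using hab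
  · intro a b hab; simpa using hab
  · rw [disjoint_left]
    rintro ⟨a, b⟩ h1 h2
    simp only [mem_image, mem_filter, Prod.mk.injEq] at h1 h2
    grind
  · rw [disjoint_left]
    rintro ⟨a, b⟩ h1 h2
    simp only [mem_union, mem_product, mem_image, mem_filter, Prod.mk.injEq] at h1 h2
    grind

theorem no_D_pair_with_one_A_B_D_neighbor {V : Type*} [Fintype V] [DecidableEq V]
    (G : SimpleGraph V) [DecidableRel G.Adj] (S : Finset V) (m : V → V)
    (hconn : G.Connected)
    (hcubic : ∀ v : V, G.degree v = 3)
    (hdom : ∀ v : V, v ∉ S → ∃ u ∈ S, G.Adj v u)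
    (hmatch : IsMatchingOn G S m)
    (hmincard : ∀ T : Finset V, IsPDS G T → S.card ≤ T.card)
    (hP1 : ∀ T : Finset V, IsPDS G T → T.card = S.card → lambdaS G S ≤ lambdaS G T)
    (hP2 : ∀ (T : Finset V) (m' : V → V),
        (∀ v : V, v ∉ T → ∃ u ∈ T, G.Adj v u) → IsMatchingOn G T m' →
        T.card = S.card → lambdaS G T = lambdaS G S →
        (setA G S m ∪ setB G S m).card ≤ (setA G T m' ∪ setB G T m').card) :
    ∀ C : Finset V, IsComponent G S C → NoLinkedDPairs G S m C →
      ¬ ∃ u ∈ C, IsDPair G S m u ∧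
        (nbrS G S u ∩ setA G S m).card = 1 ∧
        (nbrS G S u ∩ setB G S m).card = 1 ∧
        (nbrS G S u ∩ setD G S m).card = 1 := by
  rintro C - - ⟨u, -, ⟨huD, hvD⟩, hA, hB, -⟩
  obtain ⟨a, ha⟩ := card_eq_one.1 hA
  obtain ⟨b, hb⟩ := card_eq_one.1 hB
  have ha' : a ∈ nbrS G S u ∩ setA G S m := by rw [ha]; simp
  have hb' : b ∈ nbrS G S u ∩ setB G S m := by rw [hb]; simp
  simp only [nbrS, setA, setB, mem_inter, mem_filter] at ha' hb'
  simp only [setD, mem_filter] at huD hvD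
  obtain ⟨huS, hup, hvp⟩ := huD
  obtain ⟨⟨haS, hua⟩, -, hA2⟩ := ha'
  obtain ⟨⟨hbS, hub⟩, -, hbp, hcp⟩ := hb'
  obtain ⟨hvS, hvu, huv, hmv⟩ := hmatch u huS
  obtain ⟨hcS, hcb, hbc, hmc⟩ := hmatch b hbS
  have hav : a ≠ m u := by
    rintro rfl
    rw [hmv, hup, hvp] at hA2
    simp at hA2
  have hbv : b ≠ m u := by
    rintro rfl
    rw [hvp] at hbp
    simp at hbp
  have hcu : m b ≠ u := by
    intro h
    exact hbv (by rw [← h, hmc])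
  have hbu : b ≠ u := hub.ne'
  have hcv : m b ≠ m u := by
    intro h
    exact hbu (by rw [← hmc, h, hmv])
  have hab : a ≠ b := by
    rintro rfl
    rw [hcp, card_empty, add_zero] at hA2
    have hsub : insert u (insert (m a) (privates G S a)) ⊆ G.neighborFinset a := by
      intro x hx
      simp only [mem_insert, privates, mem_filter, mem_univ, true_and] at hx
      rw [SimpleGraph.mem_neighborFinset]
      rcases hx with rfl | rfl | ⟨hx, hx2⟩
      · exact hua.symm
      · exact hbc
      · have : a ∈ nbrS G S x := by rw [hx2]; simp
        simp only [nbrS, mem_filter] at this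
        exact this.2.symm
    have h1 := card_le_card hsub
    rw [SimpleGraph.card_neighborFinset_eq_degree, hcubic, card_insert_of_notMem,
      card_insert_of_notMem] at h1
    · omega
    · simp [privates, hcS]
    · simp [privates, huS, Ne.symm hcu]
  have h3 : ({a, b, m u} : Finset V).card = 3 := by
    rw [card_eq_three]; exact ⟨a, b, m u, hab, hav, hbv, rfl⟩
  have hN : G.neighborFinset u = {a, b, m u} := by
    symm
    apply eq_of_subset_of_card_le
    · intro x hx
      simp only [mem_insert, mem_singleton] at hx
      rw [SimpleGraph.mem_neighborFinset]
      rcases hx with rfl | rfl | rfl <;> assumption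
    · rw [SimpleGraph.card_neighborFinset_eq_degree, hcubic, h3]
  have hNS : ∀ x, G.Adj u x → x ∈ S := by
    intro x hx
    rw [← SimpleGraph.mem_neighborFinset, hN] at hx
    simp only [mem_insert, mem_singleton] at hx
    rcases hx with rfl | rfl | rfl <;> assumption
  -- find an outside vertex whose neighbours in S are exactly `m b` and `m u`
  have hp : ∃ p, p ∉ S ∧ nbrS G S p = {m b, m u} := by
    by_contra hno
    push Not at hno
    have hT : IsPDS G ((S.erase (m u)).erase (m b)) := by
      refine ⟨?_, fun x => if x = u then b else if x = b then u else m x, ?_⟩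
      · intro x hx
        by_cases hxc : x = m b
        · exact ⟨b, by simp [hbS, hbv, hcb.symm], by rw [hxc]; exact hbc.symm⟩
        by_cases hxv : x = m u
        · exact ⟨u, by simp [huS, hvu.symm, hcu.symm], by rw [hxv]; exact huv.symm⟩
        have hxS : x ∉ S := by
          intro h; exact hx (by simp [hxc, hxv, h])
        by_contra hnd
        push Not at hnd
        have hsub : nbrS G S x ⊆ {m b, m u} := by
          intro w hw
          simp only [nbrS, mem_filter] at hw
          by_contra hw2
          simp only [mem_insert, mem_singleton, not_or] at hw2
          exact hnd w (by simp [hw2, hw.1]) hw.2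
        have hp1 : nbrS G S x ≠ {m b} := by
          intro h
          have : x ∈ privates G S (m b) := by simp [privates, hxS, h]
          rw [hcp] at this; simp at this
        have hp2 : nbrS G S x ≠ {m u} := by
          intro h
          have : x ∈ privates G S (m u) := by simp [privates, hxS, h]
          rw [hvp] at this; simp at this
        have hp0 : nbrS G S x ≠ ∅ := by
          intro h
          obtain ⟨w, hw, hxw⟩ := hdom x hxS
          have : w ∈ nbrS G S x := by simp [nbrS, hw, hxw]
          rw [h] at this; simp at this
        apply hno x hxS
        apply hsub.antisymm
        obtain ⟨w, hw⟩ := nonempty_iff_ne_empty.2 hp0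
        have k1 : m b ∈ nbrS G S x := by
          by_contra hk
          apply hp2
          ext y
          grind
        have k2 : m u ∈ nbrS G S x := by
          by_contra hk
          apply hp1
          ext y
          grind
        intro y hy
        grind
      · intro x hx
        simp only [mem_erase] at hx ⊢
        obtain ⟨hxc, hxv, hxS⟩ := hx
        obtain ⟨hmS, hmne, hadj, hmm⟩ := hmatch x hxS
        by_cases hxu : x = u
        · subst hxu
          simp [hbu, hbS, hbv, hcb.symm, hub]
        by_cases hxb : x = b
        · subst hxb
          simp [hbu, hbu.symm, huS, hvu.symm, hcu.symm, hub.symm]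
        have e1 : m x ≠ u := by intro h; exact hxv (by rw [← h, hmm])
        have e2 : m x ≠ b := by intro h; exact hxc (by rw [← h, hmm])
        have e3 : m x ≠ m u := by intro h; exact hxu (by rw [← hmm, h, hmv])
        have e4 : m x ≠ m b := by intro h; exact hxb (by rw [← hmm, h, hmc])
        simp [hxu, hxb, e1, e2, e3, e4, hmS, hmne, hadj, hmm]
    have h1 := hmincard _ hT
    have h2 : ((S.erase (m u)).erase (m b)).card < S.card :=
      card_lt_card ((erase_subset _ _).trans_ssubset (erase_ssubset hvS))
    omega
  obtain ⟨p, hpS, hpN⟩ := hp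
  have hpv : G.Adj p (m u) := by
    have : m u ∈ nbrS G S p := by rw [hpN]; simp
    simp only [nbrS, mem_filter] at this
    exact this.2
  have hpu : p ≠ u := by rintro rfl; exact hpS huS
  have hpR : p ∉ S.erase u := fun h => hpS (mem_of_mem_erase h)
  have hmp : p ≠ m u := by rintro rfl; exact hpS hvS
  have hT : IsPDS G (insert p (S.erase u)) := by
    refine ⟨?_, fun x => if x = p then m u else if x = m u then p else m x, ?_⟩
    · intro x hx
      simp only [mem_insert, mem_erase, not_or, not_and] at hx
      by_cases hxu : x = u
      · exact ⟨b, by simp [hbu, hbS], by rw [hxu]; exact hub⟩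
      have hxS := hx.2 hxu
      obtain ⟨w, hw, hxw⟩ := hdom x hxS
      have hwu : w ≠ u := by rintro rfl; exact hxS (hNS x hxw.symm)
      exact ⟨w, by simp [hwu, hw], hxw⟩
    · intro x hx
      simp only [mem_insert, mem_erase] at hx ⊢
      rcases hx with rfl | ⟨hxu, hxS⟩
      · simp [hmp.symm, hvu, hvS, hpv]
      have hxp : x ≠ p := by rintro rfl; exact hpS hxS
      by_cases hxv : x = m u
      · subst hxv
        simp [hmp, hmp.symm, hpv.symm]
      obtain ⟨hmS, hmne, hadj, hmm⟩ := hmatch x hxS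
      have e1 : m x ≠ u := by intro h; exact hxv (by rw [← h, hmm])
      have e2 : m x ≠ m u := by intro h; exact hxu (by rw [← hmm, h, hmv])
      have e3 : m x ≠ p := by intro h; exact hpS (h ▸ hmS)
      simp [hxp, hxv, e1, e2, e3, hmS, hmne, hadj, hmm]
  have hcard : (insert p (S.erase u)).card = S.card := by
    rw [card_insert_of_notMem hpR, card_erase_add_one huS]
  have hl := hP1 _ hT hcard
  rw [lambdaS_insert G _ p hpR] at hl
  have hl2 := lambdaS_insert G (S.erase u) u (by simp)
  rw [insert_erase huS] at hl2
  have hnu : 3 ≤ (nbrS G (S.erase u) u).card := by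
    rw [← h3]
    apply card_le_card
    intro x hx
    simp only [mem_insert, mem_singleton] at hx
    simp only [nbrS, mem_filter, mem_erase]
    rcases hx with rfl | rfl | rfl
    · exact ⟨⟨hua.ne', haS⟩, hua⟩
    · exact ⟨⟨hub.ne', hbS⟩, hub⟩
    · exact ⟨⟨hvu, hvS⟩, huv⟩
  have hnp : (nbrS G (S.erase u) p).card ≤ 2 := by
    calc (nbrS G (S.erase u) p).card ≤ (nbrS G S p).card :=
          card_le_card (filter_subset_filter _ (erase_subset _ _))
      _ ≤ 2 := by rw [hpN]; exact card_le_two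
  omega
end

section
/- Under the stated setup, let 𝒞 be a connected component of G[S] that contains no linked D-pairs and no BC-pair. Then 𝒞 contains at most two D-pairs. -/
open Finset

section Helpers

variable {V : Type*} [Fintype V] [DecidableEq V] {G : SimpleGraph V} [DecidableRel G.Adj]

/-- In a cubic graph three distinct neighbours are all the neighbours. -/
lemma cubic_three (hcubic : ∀ v : V, G.degree v = 3) {v a b c d : V}
    (ha : G.Adj v a) (hb : G.Adj v b) (hc : G.Adj v c) (hd : G.Adj v d)
    (hab : a ≠ b) (hac : a ≠ c) (hbc : b ≠ c) : d = a ∨ d = b ∨ d = c := by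
  by_contra hne
  push Not at hne
  have hsub : ({a, b, c, d} : Finset V) ⊆ G.neighborFinset v := by
    intro x hx
    simp only [Finset.mem_insert, Finset.mem_singleton] at hx
    rw [SimpleGraph.mem_neighborFinset]
    rcases hx with rfl | rfl | rfl | rfl <;> assumption
  have h1 := Finset.card_le_card hsub
  rw [SimpleGraph.card_neighborFinset_eq_degree, hcubic] at h1
  have h2 : ({a, b, c, d} : Finset V).card = 4 := by
    rw [Finset.card_insert_of_notMem, Finset.card_insert_of_notMem,
      Finset.card_insert_of_notMem, Finset.card_singleton] <;> grind
  omega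

lemma mem_nbrS {S : Finset V} {x u : V} : u ∈ nbrS G S x ↔ u ∈ S ∧ G.Adj x u := by
  simp [nbrS]

lemma lambda_insert (S : Finset V) (c : V) (hc : c ∉ S) :
    lambdaS G (insert c S) = lambdaS G S + 2 * (nbrS G S c).card := by
  have key : ((insert c S ×ˢ insert c S).filter (fun p => G.Adj p.1 p.2)) =
      (((S ×ˢ S).filter (fun p => G.Adj p.1 p.2)) ∪ (nbrS G S c).image (fun u => (c, u))) ∪
        (nbrS G S c).image (fun u => (u, c)) := by
    ext ⟨x, y⟩
    simp only [Finset.mem_filter, Finset.mem_product, Finset.mem_insert, Finset.mem_union,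
      Finset.mem_image, mem_nbrS, Prod.mk.injEq]
    constructor
    · rintro ⟨⟨rfl | hx, rfl | hy⟩, h⟩
      · exact absurd h (G.irrefl)
      · exact Or.inl (Or.inr ⟨y, ⟨hy, h⟩, rfl, rfl⟩)
      · exact Or.inr ⟨x, ⟨hx, h.symm⟩, rfl, rfl⟩
      · exact Or.inl (Or.inl ⟨⟨hx, hy⟩, h⟩)
    · rintro ((⟨⟨hx, hy⟩, h⟩ | ⟨u, ⟨hu, h⟩, rfl, rfl⟩) | ⟨u, ⟨hu, h⟩, rfl, rfl⟩)
      · exact ⟨⟨Or.inr hx, Or.inr hy⟩, h⟩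
      · exact ⟨⟨Or.inl rfl, Or.inr hu⟩, h⟩
      · exact ⟨⟨Or.inr hu, Or.inl rfl⟩, h.symm⟩
  unfold lambdaS
  rw [key, Finset.card_union_of_disjoint, Finset.card_union_of_disjoint,
    Finset.card_image_of_injective, Finset.card_image_of_injective]
  · ring
  · intro a b h; simpa using h
  · intro a b h; simpa using h
  · rw [Finset.disjoint_left]
    rintro ⟨x, y⟩ h1 h2
    simp only [Finset.mem_filter, Finset.mem_product, Finset.mem_image, Prod.mk.injEq] at h1 h2
    grind
  · rw [Finset.disjoint_left]
    rintro ⟨x, y⟩ h1 h2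
    simp only [Finset.mem_filter, Finset.mem_product, Finset.mem_image, Finset.mem_union,
      mem_nbrS, Prod.mk.injEq] at h1 h2
    grind

/-- Swapping `a, b` for `c, d`: comparison of the numbers of edges. -/
lemma lambda_swap (S : Finset V) {a b c d : V} (ha : a ∈ S) (hb : b ∈ S) (hab : a ≠ b)
    (hc : c ∉ S) (hd : d ∉ S) (hcd : c ≠ d) {i j k l : ℕ}
    (hi : i ≤ (nbrS G (S \ {a, b}) a).card) (hj : j ≤ (nbrS G (S \ {a, b}) b).card)
    (hk : (nbrS G (S \ {a, b}) c).card ≤ k)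
    (hl : (nbrS G (insert c (S \ {a, b})) d).card ≤ l) (h : k + l < i + j) :
    lambdaS G (insert d (insert c (S \ {a, b}))) < lambdaS G S := by
  have e1 : S = insert b (insert a (S \ {a, b})) := by
    ext x; simp only [Finset.mem_insert, Finset.mem_sdiff, Finset.mem_singleton]; grind
  have h1 : lambdaS G S = lambdaS G (S \ {a, b}) + 2 * (nbrS G (S \ {a, b}) a).card
      + 2 * (nbrS G (insert a (S \ {a, b})) b).card := by
    conv_lhs => rw [e1]
    rw [lambda_insert, lambda_insert]
    · simp
    · simp [hab.symm]
  have h2 : (nbrS G (S \ {a, b}) b).card ≤ (nbrS G (insert a (S \ {a, b})) b).card := by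
    apply Finset.card_le_card
    intro x; simp only [mem_nbrS, Finset.mem_insert]; tauto
  rw [lambda_insert, lambda_insert]
  · omega
  · simp [hc]
  · simp [hd, hcd.symm]

/-- `p` has no private neighbour. -/
def NoPriv (G : SimpleGraph V) (S : Finset V) (p : V) : Prop :=
  ∀ x, x ∉ S → G.Adj x p → ∃ q ∈ S, G.Adj x q ∧ q ≠ p

lemma noPriv_of {S : Finset V} {p : V} (hp : p ∈ S) (h : privates G S p = ∅) :
    NoPriv G S p := by
  intro x hx hxp
  by_contra hcon
  push Not at hcon
  have : x ∈ privates G S p := by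
    simp only [privates, Finset.mem_filter, Finset.mem_univ, true_and]
    refine ⟨hx, ?_⟩
    ext y
    simp only [mem_nbrS, Finset.mem_singleton]
    constructor
    · rintro ⟨h1, h2⟩; exact hcon y h1 h2
    · rintro rfl; exact ⟨hp, hxp⟩
  rw [h] at this
  simp at this

lemma pair_removal {S : Finset V}
    (hdom : ∀ v : V, v ∉ S → ∃ u ∈ S, G.Adj v u)
    (hmincard : ∀ T : Finset V, IsPDS G T → S.card ≤ T.card)
    {a b : V} (ha : a ∈ S) (hpa : NoPriv G S a) (hpb : NoPriv G S b)
    {m' : V → V} (hm' : IsMatchingOn G (S \ {a, b}) m')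
    {a' b' : V} (ha' : a' ∈ S \ {a, b}) (haa : G.Adj a a')
    (hb' : b' ∈ S \ {a, b}) (hbb : G.Adj b b') :
    ∃ x, x ∉ S ∧ G.Adj x a ∧ G.Adj x b ∧ ∀ s ∈ S, G.Adj x s → s = a ∨ s = b := by
  by_contra hcon
  push Not at hcon
  have hP : IsPDS G (S \ {a, b}) := by
    refine ⟨?_, m', hm'⟩
    intro v hv
    by_cases hvS : v ∈ S
    · have : v = a ∨ v = b := by
        simp only [Finset.mem_sdiff, Finset.mem_insert, Finset.mem_singleton] at hv; tauto
      rcases this with rfl | rfl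
      · exact ⟨a', ha', haa⟩
      · exact ⟨b', hb', hbb⟩
    · by_cases h1 : G.Adj v a
      · by_cases h2 : G.Adj v b
        · obtain ⟨s, hs, h3, h4⟩ := hcon v hvS h1 h2
          exact ⟨s, by simp [hs, h4], h3⟩
        · obtain ⟨q, hq, h3, h4⟩ := hpa v hvS h1
          exact ⟨q, by simp [hq, h4]; rintro rfl; exact h2 h3, h3⟩
      · by_cases h2 : G.Adj v b
        · obtain ⟨q, hq, h3, h4⟩ := hpb v hvS h2
          exact ⟨q, by simp [hq, h4]; rintro rfl; exact h1 h3, h3⟩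
        · obtain ⟨q, hq, h3⟩ := hdom v hvS
          refine ⟨q, ?_, h3⟩
          simp only [Finset.mem_sdiff, Finset.mem_insert, Finset.mem_singleton]
          grind
  have h1 := hmincard _ hP
  have h2 : (S \ {a, b}).card < S.card := by
    apply Finset.card_lt_card
    rw [Finset.ssubset_iff_of_subset Finset.sdiff_subset]
    exact ⟨a, ha, by simp⟩
  omega

/-- Case 2: the two chains leave the pair `{v, m v}` at different ends. -/
lemma case_two {S : Finset V} {m : V → V}
    (hcubic : ∀ v : V, G.degree v = 3)
    (hdom : ∀ v : V, v ∉ S → ∃ u ∈ S, G.Adj v u)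
    (hmatch : IsMatchingOn G S m)
    (hmincard : ∀ T : Finset V, IsPDS G T → S.card ≤ T.card)
    {v a b x₁ x₂ u w : V} (hv : v ∈ S) (ha : a ∈ S) (hb : b ∈ S)
    (hva : G.Adj v a) (hav : a ≠ m v) (hvb : G.Adj (m v) b) (hbv : b ≠ v)
    (hx₁ : x₁ ∉ S) (hx₁v : G.Adj x₁ (m v)) (hu : u ∈ S) (hx₁u : G.Adj x₁ u)
    (huv : u ≠ v) (humv : u ≠ m v)
    (hx₂ : x₂ ∉ S) (hx₂v : G.Adj x₂ v) (hw : w ∈ S) (hx₂w : G.Adj x₂ w)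
    (hwv : w ≠ v) (hwmv : w ≠ m v) : False := by
  obtain ⟨hmv, hne, hadj, hmm⟩ := hmatch v hv
  have h1 : ∀ z, G.Adj v z → z = m v ∨ z = a ∨ z = x₂ := fun z hz =>
    cubic_three hcubic hadj hva hx₂v.symm hz hav.symm (by grind) (by grind)
  have h2 : ∀ z, G.Adj (m v) z → z = v ∨ z = b ∨ z = x₁ := fun z hz =>
    cubic_three hcubic hadj.symm hvb hx₁v.symm hz hbv.symm (by grind) (by grind)
  have hP : IsPDS G (S \ {v, m v}) := by
    refine ⟨?_, m, ?_⟩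
    · intro z hz
      by_cases hzv : z = v
      · exact ⟨a, by have := hva.ne; grind, hzv ▸ hva⟩
      by_cases hzm : z = m v
      · exact ⟨b, by have := hvb.ne; grind, hzm ▸ hvb⟩
      have hzS : z ∉ S := by grind
      by_cases hz1 : G.Adj z v
      · have : z = x₂ := by have := h1 z hz1.symm; grind
        subst this
        exact ⟨w, by grind, hx₂w⟩
      by_cases hz2 : G.Adj z (m v)
      · have : z = x₁ := by have := h2 z hz2.symm; grind
        subst this
        exact ⟨u, by grind, hx₁u⟩
      obtain ⟨q, hq, h3⟩ := hdom z hzS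
      exact ⟨q, by grind, h3⟩
    · intro z hz
      obtain ⟨h3, h4, h5, h6⟩ := hmatch z (by grind)
      refine ⟨?_, h4, h5, h6⟩
      grind
  have h1 := hmincard _ hP
  have h2 : (S \ {v, m v}).card < S.card := by
    apply Finset.card_lt_card
    rw [Finset.ssubset_iff_of_subset Finset.sdiff_subset]
    exact ⟨v, hv, by simp⟩
  omega

/-- Case 1, when `x₁` and `x₂` are adjacent: a common outside neighbour of `p` and `m r`. -/
lemma case_one_adj {S : Finset V} {m : V → V}
    (hcubic : ∀ v : V, G.degree v = 3)
    (hdom : ∀ v : V, v ∉ S → ∃ u ∈ S, G.Adj v u)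
    (hmatch : IsMatchingOn G S m)
    (hmincard : ∀ T : Finset V, IsPDS G T → S.card ≤ T.card)
    {v p r : V} (hv : v ∈ S) (hp : p ∈ S) (hr : r ∈ S)
    (hpv : p ≠ v) (hpmv : p ≠ m v) (hrv : r ≠ v) (hrmv : r ≠ m v) (hrp : r ≠ p)
    (hrmp : r ≠ m p)
    (hPp : NoPriv G S p) (hPr : NoPriv G S (m r))
    {m₂ : V → V} (hm₂ : IsMatchingOn G (S \ {m v, m r}) m₂) (hm₂p : m₂ p = m p)
    {x₁ x₂ : V} (hx₁ : x₁ ∉ S) (hx₂ : x₂ ∉ S)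
    (hx₁p : G.Adj x₁ (m p)) (hx₁v : G.Adj x₁ (m v))
    (_hx₂r : G.Adj x₂ (m r)) (hx₂v : G.Adj x₂ (m v)) (hx : G.Adj x₁ x₂) :
    ∃ t, t ∉ S ∧ G.Adj t p ∧ G.Adj t (m r) ∧ ∀ s ∈ S, G.Adj t s → s = p ∨ s = m r := by
  obtain ⟨hmvS, hmv1, hmv2, hmv3⟩ := hmatch v hv
  obtain ⟨hmpS, hmp1, hmp2, hmp3⟩ := hmatch p hp
  obtain ⟨hmrS, hmr1, hmr2, hmr3⟩ := hmatch r hr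
  have hnv : ∀ z, G.Adj (m v) z → z = v ∨ z = x₁ ∨ z = x₂ := fun z hz =>
    cubic_three hcubic hmv2.symm hx₁v.symm hx₂v.symm hz (by grind) (by grind) hx.ne
  by_contra hcon
  push Not at hcon
  have hP : IsPDS G (insert x₁ (S \ {p, m r, m v})) := by
    refine ⟨?_, fun z => if z = m p then x₁ else if z = x₁ then m p else m₂ z, ?_⟩
    · intro z hz
      by_cases hz1 : z = p
      · exact ⟨m p, by grind, hz1 ▸ hmp2⟩
      by_cases hz2 : z = m r
      · exact ⟨r, by grind, hz2 ▸ hmr2.symm⟩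
      by_cases hz3 : z = m v
      · exact ⟨v, by grind, hz3 ▸ hmv2.symm⟩
      by_cases hz4 : z = x₂
      · exact ⟨x₁, by grind, hz4 ▸ hx.symm⟩
      have hzS : z ∉ S := by grind
      have hzv : ¬ G.Adj z (m v) := by
        intro h; have := hnv z h.symm; grind
      have : ∃ q ∈ S, G.Adj z q ∧ q ≠ p ∧ q ≠ m r := by
        by_cases h1 : G.Adj z p
        · by_cases h2 : G.Adj z (m r)
          · obtain ⟨s, h3, h4, h5⟩ := hcon z hzS h1 h2
            exact ⟨s, h3, h4, h5⟩
          · obtain ⟨s, h3, h4, h5⟩ := hPp z hzS h1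
            exact ⟨s, h3, h4, h5, by grind⟩
        · by_cases h2 : G.Adj z (m r)
          · obtain ⟨s, h3, h4, h5⟩ := hPr z hzS h2
            exact ⟨s, h3, h4, by grind, h5⟩
          · obtain ⟨s, h3, h4⟩ := hdom z hzS
            exact ⟨s, h3, h4, by grind, by grind⟩
      obtain ⟨q, h1, h2, h3, h4⟩ := this
      exact ⟨q, by grind, h2⟩
    · have hpm : p ∈ S \ {m v, m r} := by grind
      obtain ⟨-, -, -, hm₂mp⟩ := hm₂ p hpm
      intro z hz
      by_cases hz1 : z = m p
      · subst hz1
        have : x₁ ≠ m p := by grind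
        simp only [if_true, if_neg this]
        exact ⟨by grind, this, hx₁p.symm, trivial⟩
      by_cases hz2 : z = x₁
      · subst hz2
        simp only [if_true, if_neg hz1]
        exact ⟨by grind, Ne.symm hz1, hx₁p, trivial⟩
      obtain ⟨h1, h2, h3, h4⟩ := hm₂ z (by grind)
      have h5 : m₂ z ≠ m p := by
        intro h; rw [h, ← hm₂p, hm₂mp] at h4; grind
      have h6 : m₂ z ≠ x₁ := by grind
      have h7 : m₂ z ≠ p := by intro h; rw [h, hm₂p] at h4; exact hz1 h4.symm
      simp only [if_neg hz1, if_neg hz2, if_neg h5, if_neg h6]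
      exact ⟨by grind, h2, h3, h4⟩
  have h1 := hmincard _ hP
  have h2 : (S \ {p, m r, m v}).card + 2 ≤ S.card - 1 + 1 := by
    have h3 : ({p, m r} : Finset V).card = 2 := Finset.card_pair (by grind)
    have h4 : (S \ {p, m r, m v}).card + ({p, m r} : Finset V).card ≤ S.card := by
      rw [← Finset.card_union_of_disjoint]
      · apply Finset.card_le_card; intro z; grind
      · rw [Finset.disjoint_left]; intro z; grind
    omega
  have h3 : (insert x₁ (S \ {p, m r, m v})).card ≤ (S \ {p, m r, m v}).card + 1 :=
    Finset.card_insert_le _ _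
  have h4 : 0 < S.card := Finset.card_pos.2 ⟨v, hv⟩
  omega

lemma card_swap {S : Finset V} {a b c d : V} (ha : a ∈ S) (hb : b ∈ S) (hab : a ≠ b)
    (hc : c ∉ S) (hd : d ∉ S) (hcd : c ≠ d) :
    (insert d (insert c (S \ {a, b}))).card = S.card := by
  rw [Finset.card_insert_of_notMem (by grind), Finset.card_insert_of_notMem (by grind),
    Finset.card_sdiff_of_subset (by grind), Finset.card_pair hab]
  have : ({a, b} : Finset V).card ≤ S.card := Finset.card_le_card (by grind)
  rw [Finset.card_pair hab] at this
  omega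

lemma two_le_nbr {T : Finset V} {x a b : V} (ha : a ∈ T) (hb : b ∈ T) (hab : a ≠ b)
    (h1 : G.Adj x a) (h2 : G.Adj x b) : 2 ≤ (nbrS G T x).card := by
  rw [← Finset.card_pair hab]
  apply Finset.card_le_card
  intro z hz
  simp only [Finset.mem_insert, Finset.mem_singleton] at hz
  rw [mem_nbrS]
  rcases hz with rfl | rfl <;> exact ⟨by assumption, by assumption⟩

lemma nbr_le_one {T : Finset V} {x a : V} (h : ∀ s ∈ T, G.Adj x s → s = a) :
    (nbrS G T x).card ≤ 1 := by
  rw [← Finset.card_singleton a]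
  apply Finset.card_le_card
  intro z hz
  rw [mem_nbrS] at hz
  simp [h z hz.1 hz.2]

lemma nbr_le_two {T : Finset V} {x a b : V} (h : ∀ s ∈ T, G.Adj x s → s = a ∨ s = b) :
    (nbrS G T x).card ≤ 2 := by
  refine le_trans (Finset.card_le_card (t := {a, b}) ?_) (Finset.card_le_two)
  intro z hz
  rw [mem_nbrS] at hz
  simp [h z hz.1 hz.2]

/-- Case 1: both chains leave the pair `{v, m v}` at `v`. -/
lemma case_one {S : Finset V} {m : V → V}
    (hcubic : ∀ v : V, G.degree v = 3)
    (hdom : ∀ v : V, v ∉ S → ∃ u ∈ S, G.Adj v u)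
    (hmatch : IsMatchingOn G S m)
    (hmincard : ∀ T : Finset V, IsPDS G T → S.card ≤ T.card)
    (hP1 : ∀ T : Finset V, IsPDS G T → T.card = S.card → lambdaS G S ≤ lambdaS G T)
    {v p r : V} (hv : v ∈ S) (hp : p ∈ S) (hr : r ∈ S)
    (hpv : p ≠ v) (hpmv : p ≠ m v) (hrv : r ≠ v) (hrmv : r ≠ m v) (hrp : r ≠ p)
    (hrmp : r ≠ m p)
    (hPp : NoPriv G S p) (hPmp : NoPriv G S (m p))
    (hPr : NoPriv G S r) (hPmr : NoPriv G S (m r))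
    {m₁ : V → V} (hm₁ : IsMatchingOn G (S \ {m v, m p}) m₁) (hm₁r : m₁ r = m r)
    {m₂ : V → V} (hm₂ : IsMatchingOn G (S \ {m v, m r}) m₂) (hm₂p : m₂ p = m p)
    {a b : V} (ha : a ∈ S) (hpa : G.Adj p a) (hamp : a ≠ m p) (hamv : a ≠ m v) (har : a ≠ r)
    (hb : b ∈ S) (hrb : G.Adj r b) (hbmr : b ≠ m r) (hbp : b ≠ p)
    {x₁ x₂ : V} (hx₁ : x₁ ∉ S) (hx₂ : x₂ ∉ S)
    (hx₁p : G.Adj x₁ (m p)) (hx₁v : G.Adj x₁ (m v))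
    (hx₁' : ∀ s ∈ S, G.Adj x₁ s → s = m v ∨ s = m p)
    (hx₂r : G.Adj x₂ (m r)) (hx₂v : G.Adj x₂ (m v))
    (hx₂' : ∀ s ∈ S, G.Adj x₂ s → s = m v ∨ s = m r) : False := by
  obtain ⟨hmvS, hmv1, hmv2, hmv3⟩ := hmatch v hv
  obtain ⟨hmpS, hmp1, hmp2, hmp3⟩ := hmatch p hp
  obtain ⟨hmrS, hmr1, hmr2, hmr3⟩ := hmatch r hr
  have hx₁₂ : x₁ ≠ x₂ := by
    rintro rfl
    have := hx₂' _ hmpS hx₁p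
    grind
  have hpa' := hpa.ne
  have hrb' := hrb.ne
  by_cases hx : G.Adj x₁ x₂
  · obtain ⟨t, ht, htp, htr, ht'⟩ := case_one_adj hcubic hdom hmatch hmincard hv hp hr hpv hpmv hrv
      hrmv hrp hrmp hPp hPmr hm₂ hm₂p hx₁ hx₂ hx₁p hx₁v hx₂r hx₂v hx
    obtain ⟨y, hy, hyr, hyp, hy'⟩ := case_one_adj hcubic hdom hmatch hmincard hv hr hp hrv hrmv hpv
      hpmv hrp.symm (by grind) hPr hPmp hm₁ hm₁r hx₂ hx₁ hx₂r hx₂v hx₁p hx₁v hx.symm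
    have hty : t ≠ y := by
      rintro rfl
      have := ht' _ hr hyr
      grind
    have hlam : lambdaS G (insert t (insert y (S \ {p, r}))) < lambdaS G S := by
      refine lambda_swap S hp hr hrp.symm hy ht hty.symm (i := 2) (j := 2) (k := 1) (l := 2)
        ?_ ?_ ?_ ?_ (by norm_num)
      · exact two_le_nbr (a := m p) (b := a) (by grind) (by grind) hamp.symm hmp2 hpa
      · exact two_le_nbr (a := m r) (b := b) (by grind) (by grind) hbmr.symm hmr2 hrb
      · exact nbr_le_one (a := m p) (fun s hs h => by have := hy' s (by grind) h; grind)
      · refine nbr_le_two (a := m r) (b := y) (fun s hs h => ?_)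
        by_cases hsy : s = y
        · exact Or.inr hsy
        · have := ht' s (by grind) h; grind
    have hnp : ∀ z, G.Adj p z → z = m p ∨ z = a ∨ z = t := fun z hz =>
      cubic_three hcubic hmp2 hpa htp.symm hz hamp.symm (by grind) (by grind)
    have hnr : ∀ z, G.Adj r z → z = m r ∨ z = b ∨ z = y := fun z hz =>
      cubic_three hcubic hmr2 hrb hyr.symm hz hbmr.symm (by grind) (by grind)
    have hP : IsPDS G (insert t (insert y (S \ {p, r}))) := by
      refine ⟨?_, fun z => if z = m p then y else if z = y then m p else
        if z = m r then t else if z = t then m r else m z, ?_⟩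
      · intro z hz
        by_cases hz1 : z = p
        · exact ⟨m p, by grind, hz1 ▸ hmp2⟩
        by_cases hz2 : z = r
        · exact ⟨m r, by grind, hz2 ▸ hmr2⟩
        have hzS : z ∉ S := by grind
        obtain ⟨q, hq, hzq⟩ := hdom z hzS
        have h1 : q ≠ p := by rintro rfl; have := hnp z hzq.symm; grind
        have h2 : q ≠ r := by rintro rfl; have := hnr z hzq.symm; grind
        exact ⟨q, by grind, hzq⟩
      · intro z hz
        by_cases h1 : z = m p
        · subst h1
          have : y ≠ m p := by grind
          simp only [if_true, if_neg this]
          exact ⟨by grind, this, hyp.symm, trivial⟩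
        by_cases h2 : z = y
        · subst h2
          simp only [if_true, if_neg h1]
          exact ⟨by grind, Ne.symm h1, hyp, trivial⟩
        by_cases h3 : z = m r
        · subst h3
          have g1 : t ≠ m p := by grind
          have g3 : t ≠ m r := by grind
          simp only [if_true, if_neg h1, if_neg h2, if_neg hty, if_neg g1, if_neg g3]
          exact ⟨by grind, g3, htr.symm, trivial⟩
        by_cases h4 : z = t
        · subst h4
          have g1 : m r ≠ m p := by grind
          have g3 : m r ≠ y := by grind
          simp only [if_true, if_neg h1, if_neg h2, if_neg h3, if_neg g1, if_neg g3]
          exact ⟨by grind, Ne.symm h3, htr, trivial⟩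
        obtain ⟨k1, k2, k3, k4⟩ := hmatch z (by grind)
        have g1 : m z ≠ m p := by grind
        have g2 : m z ≠ y := by grind
        have g3 : m z ≠ m r := by grind
        have g4 : m z ≠ t := by grind
        simp only [if_neg h1, if_neg h2, if_neg h3, if_neg h4, if_neg g1, if_neg g2, if_neg g3,
          if_neg g4]
        exact ⟨by grind, k2, k3, k4⟩
    have := hP1 _ hP (card_swap hp hr hrp.symm hy ht hty.symm)
    omega
  · have hlam : lambdaS G (insert x₂ (insert x₁ (S \ {p, m v}))) < lambdaS G S := by
      refine lambda_swap S hp hmvS hpmv hx₁ hx₂ hx₁₂ (i := 2) (j := 1) (k := 1) (l := 1)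
        ?_ ?_ ?_ ?_ (by norm_num)
      · exact two_le_nbr (a := m p) (b := a) (by grind) (by grind) hamp.symm hmp2 hpa
      · exact Finset.card_pos.2 ⟨v, by rw [mem_nbrS]; exact ⟨by grind, hmv2.symm⟩⟩
      · exact nbr_le_one (a := m p) (fun s hs h => by have := hx₁' s (by grind) h; grind)
      · refine nbr_le_one (a := m r) (fun s hs h => ?_)
        by_cases hsy : s = x₁
        · subst hsy; exact absurd h.symm hx
        · have := hx₂' s (by grind) h; grind
    have hnv : ∀ z, G.Adj (m v) z → z = v ∨ z = x₁ ∨ z = x₂ := fun z hz =>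
      cubic_three hcubic hmv2.symm hx₁v.symm hx₂v.symm hz (by grind) (by grind) hx₁₂
    have hP : IsPDS G (insert x₂ (insert x₁ (S \ {p, m v}))) := by
      refine ⟨?_, fun z => if z = m p then x₁ else if z = x₁ then m p else
        if z = m r then x₂ else if z = x₂ then m r else m₂ z, ?_⟩
      · intro z hz
        by_cases hz1 : z = p
        · exact ⟨m p, by grind, hz1 ▸ hmp2⟩
        by_cases hz2 : z = m v
        · exact ⟨v, by grind, hz2 ▸ hmv2.symm⟩
        have hzS : z ∉ S := by grind
        have hzv : ¬ G.Adj z (m v) := by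
          intro h; have := hnv z h.symm; grind
        by_cases hzp : G.Adj z p
        · obtain ⟨q, hq, h1, h2⟩ := hPp z hzS hzp
          exact ⟨q, by grind, h1⟩
        obtain ⟨q, hq, hzq⟩ := hdom z hzS
        exact ⟨q, by grind, hzq⟩
      · have hpm : p ∈ S \ {m v, m r} := by grind
        obtain ⟨-, -, -, hm₂mp⟩ := hm₂ p hpm
        intro z hz
        by_cases h1 : z = m p
        · subst h1
          have : x₁ ≠ m p := by grind
          simp only [if_true, if_neg this]
          exact ⟨by grind, this, hx₁p.symm, trivial⟩
        by_cases h2 : z = x₁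
        · subst h2
          simp only [if_true, if_neg h1]
          exact ⟨by grind, Ne.symm h1, hx₁p, trivial⟩
        by_cases h3 : z = m r
        · subst h3
          have g1 : x₂ ≠ m p := by grind
          have g3 : x₂ ≠ m r := by grind
          simp only [if_true, if_neg h1, if_neg h2, if_neg hx₁₂.symm, if_neg g1, if_neg g3]
          exact ⟨by grind, g3, hx₂r.symm, trivial⟩
        by_cases h4 : z = x₂
        · subst h4
          have g1 : m r ≠ m p := by grind
          have g3 : m r ≠ x₁ := by grind
          simp only [if_true, if_neg h1, if_neg h2, if_neg h3, if_neg g1, if_neg g3]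
          exact ⟨by grind, Ne.symm h3, hx₂r, trivial⟩
        obtain ⟨k1, k2, k3, k4⟩ := hm₂ z (by grind)
        have g1 : m₂ z ≠ m p := by
          intro h; rw [h, ← hm₂p, hm₂mp] at k4; grind
        have g2 : m₂ z ≠ x₁ := by grind
        have g3 : m₂ z ≠ m r := by grind
        have g4 : m₂ z ≠ x₂ := by grind
        have g5 : m₂ z ≠ p := by intro h; rw [h, hm₂p] at k4; exact h1 k4.symm
        simp only [if_neg h1, if_neg h2, if_neg h3, if_neg h4, if_neg g1, if_neg g2, if_neg g3,
          if_neg g4]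
        exact ⟨by grind, k2, k3, k4⟩
    have := hP1 _ hP (card_swap hp hmvS hpmv hx₁ hx₂ hx₁₂)
    omega

/-- Alternating chains starting at `p` through pairs outside `D`. -/
inductive Reach (G : SimpleGraph V) (m : V → V) (C D : Finset V) (p : V) : V → Prop
  | base : Reach G m C D p p
  | step {z a : V} : Reach G m C D p z → a ∈ C → a ∉ D → G.Adj z a → a ≠ m z →
      Reach G m C D p (m a)

/-- Two vertices of distinct `D`-pairs joined by a chain. -/
def Link (G : SimpleGraph V) (m : V → V) (C D : Finset V) (p q : V) : Prop :=
  q ∈ C ∧ q ∈ D ∧ q ≠ p ∧ q ≠ m p ∧ ∃ z, Reach G m C D p z ∧ G.Adj z q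

section Chains

variable {S C D : Finset V} {m : V → V}

lemma reach_mem (hmatch : IsMatchingOn G S m) (hCS : C ⊆ S)
    (hCm : ∀ u ∈ C, m u ∈ C) (hDm : ∀ u ∈ C, m u ∈ D → u ∈ D)
    {p z : V} (hp : p ∈ C) (h : Reach G m C D p z) : z ∈ C ∧ (z = p ∨ z ∉ D) := by
  cases h with
  | base => exact ⟨hp, Or.inl rfl⟩
  | step h1 h2 h3 h4 h5 => exact ⟨hCm _ h2, Or.inr fun h => h3 (hDm _ h2 h)⟩

lemma reach_matching (hmatch : IsMatchingOn G S m) (hCS : C ⊆ S)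
    (hCm : ∀ u ∈ C, m u ∈ C) (hDm : ∀ u ∈ C, m u ∈ D → u ∈ D)
    (hDm' : ∀ u ∈ D, m u ∈ D)
    (hA : ∀ a ∈ C, a ∉ D → ∀ y₁ ∈ S, ∀ y₂ ∈ S, G.Adj a y₁ → G.Adj a y₂ → y₁ ≠ m a →
      y₂ ≠ m a → y₁ = y₂)
    {p z : V} (hp : p ∈ C) (hpD : p ∈ D) (h : Reach G m C D p z) :
    ∃ m' : V → V, IsMatchingOn G (S \ {m p, z}) m' ∧
      ∀ d ∈ D, d ≠ p → d ≠ m p → m' d = m d := by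
  induction h with
  | base =>
    refine ⟨m, ?_, fun _ _ _ _ => rfl⟩
    intro u hu
    obtain ⟨h1, h2, h3, h4⟩ := hmatch u (by grind)
    obtain ⟨g1, g2, g3, g4⟩ := hmatch p (hCS hp)
    exact ⟨by grind, h2, h3, h4⟩
  | @step z a hz haC haD hadj hne ih =>
    obtain ⟨m', hm', hfix⟩ := ih
    obtain ⟨hzC, hzD⟩ := reach_mem hmatch hCS hCm hDm hp hz
    have hmpD := hDm' p hpD
    obtain ⟨g1, g2, g3, g4⟩ := hmatch p (hCS hp)
    obtain ⟨a1, a2, a3, a4⟩ := hmatch a (hCS haC)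
    obtain ⟨z1, z2, z3, z4⟩ := hmatch z (hCS hzC)
    have hza := hadj.ne
    have hzS := hCS hzC
    have haS := hCS haC
    have hazm : z ≠ m a := by grind
    obtain ⟨b1, b2, b3, b4⟩ := hm' a (by grind)
    have hma : m' a = m a := by
      by_contra hcon
      have := hA a haC haD (m' a) (by grind) z hzS b3 hadj.symm hcon hazm
      grind
    refine ⟨fun x => if x = z then a else if x = a then z else m' x, ?_, ?_⟩
    · intro u hu
      by_cases h1 : u = z
      · subst h1
        simp only [if_true, if_neg hza.symm]
        exact ⟨by grind, hza.symm, hadj, trivial⟩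
      by_cases h2 : u = a
      · subst h2
        simp only [if_true, if_neg h1]
        exact ⟨by grind, hza, hadj.symm, trivial⟩
      obtain ⟨c1, c2, c3, c4⟩ := hm' u (by grind)
      have e1 : m' u ≠ z := by grind
      have e2 : m' u ≠ a := by
        intro h; rw [h, hma] at c4; grind
      have e3 : m' u ≠ m a := by
        intro h; rw [h, ← hma, b4] at c4; exact h2 c4.symm
      simp only [if_neg h1, if_neg h2, if_neg e1, if_neg e2]
      exact ⟨by grind, c2, c3, c4⟩
    · intro d hd h1 h2
      have e1 : d ≠ z := by grind
      have e2 : d ≠ a := by grind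
      simp only [if_neg e1, if_neg e2]
      exact hfix d hd h1 h2

lemma link_matching (hmatch : IsMatchingOn G S m) (hCS : C ⊆ S)
    (hCm : ∀ u ∈ C, m u ∈ C) (hDm : ∀ u ∈ C, m u ∈ D → u ∈ D)
    (hDm' : ∀ u ∈ D, m u ∈ D)
    (hA : ∀ a ∈ C, a ∉ D → ∀ y₁ ∈ S, ∀ y₂ ∈ S, G.Adj a y₁ → G.Adj a y₂ → y₁ ≠ m a →
      y₂ ≠ m a → y₁ = y₂)
    (hN : ∀ u ∈ C, ∀ v ∈ C, u ∈ D → v ∈ D → v ≠ u → v ≠ m u → ¬ G.Adj u v)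
    {p q : V} (hp : p ∈ C) (hpD : p ∈ D) (h : Link G m C D p q) :
    (∃ m' : V → V, IsMatchingOn G (S \ {m p, m q}) m' ∧
      ∀ d ∈ D, d ≠ p → d ≠ m p → d ≠ q → d ≠ m q → m' d = m d) ∧
    ∃ z ∈ C, z ∉ D ∧ Reach G m C D p z ∧ G.Adj q z := by
  obtain ⟨hqC, hqD, hqp, hqmp, z, hz, hadj⟩ := h
  obtain ⟨hzC, hzD⟩ := reach_mem hmatch hCS hCm hDm hp hz
  have hzp : z ≠ p := by
    rintro rfl
    exact hN z hp q hqC hpD hqD hqp hqmp hadj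
  have hzD : z ∉ D := by tauto
  refine ⟨?_, z, hzC, hzD, hz, hadj.symm⟩
  obtain ⟨m', hm', hfix⟩ := reach_matching hmatch hCS hCm hDm hDm' hA hp hpD hz
  have hmpD := hDm' p hpD
  have hmqD := hDm' q hqD
  obtain ⟨g1, g2, g3, g4⟩ := hmatch p (hCS hp)
  obtain ⟨a1, a2, a3, a4⟩ := hmatch q (hCS hqC)
  have hzS := hCS hzC
  have hqS := hCS hqC
  have hzq := hadj.ne
  obtain ⟨b1, b2, b3, b4⟩ := hm' q (by grind)
  have hmq := hfix q hqD hqp hqmp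
  refine ⟨fun x => if x = z then q else if x = q then z else m' x, ?_, ?_⟩
  · intro u hu
    by_cases h1 : u = z
    · subst h1
      simp only [if_true, if_neg hzq.symm]
      exact ⟨by grind, hzq.symm, hadj, trivial⟩
    by_cases h2 : u = q
    · subst h2
      simp only [if_true, if_neg h1]
      exact ⟨by grind, hzq, hadj.symm, trivial⟩
    obtain ⟨c1, c2, c3, c4⟩ := hm' u (by grind)
    have e1 : m' u ≠ z := by grind
    have e2 : m' u ≠ q := by
      intro h; rw [h, hmq] at c4; grind
    have e3 : m' u ≠ m q := by
      intro h; rw [h, ← hmq, b4] at c4; exact h2 c4.symm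
    simp only [if_neg h1, if_neg h2, if_neg e1, if_neg e2]
    exact ⟨by grind, c2, c3, c4⟩
  · intro d hd h1 h2 h3 h4
    have e1 : d ≠ z := by grind
    simp only [if_neg e1, if_neg h3]
    exact hfix d hd h1 h2

lemma reach_rev (hmatch : IsMatchingOn G S m) (hCS : C ⊆ S)
    (hCm : ∀ u ∈ C, m u ∈ C) (hDm : ∀ u ∈ C, m u ∈ D → u ∈ D)
    {p q z : V} (hp : p ∈ C) (hq : q ∈ C) (h : Reach G m C D p z) :
    ∀ y, Reach G m C D q y → G.Adj y z → z ≠ m y → ∃ y', Reach G m C D q y' ∧ G.Adj y' p := by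
  induction h with
  | base => intro y hy hadj _; exact ⟨y, hy, hadj⟩
  | @step z a hz haC haD hadj hne ih =>
    intro y hy hya hyne
    obtain ⟨a1, a2, a3, a4⟩ := hmatch a (hCS haC)
    obtain ⟨hzC, -⟩ := reach_mem hmatch hCS hCm hDm hp hz
    obtain ⟨z1, z2, z3, z4⟩ := hmatch z (hCS hzC)
    have h1 : Reach G m C D q (m (m a)) :=
      Reach.step hy (hCm a haC) (fun h => haD (hDm a haC h)) hya hyne
    rw [a4] at h1
    exact ih a h1 hadj.symm (by grind)

lemma link_symm (hmatch : IsMatchingOn G S m) (hCS : C ⊆ S)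
    (hCm : ∀ u ∈ C, m u ∈ C) (hDm : ∀ u ∈ C, m u ∈ D → u ∈ D)
    (hDm' : ∀ u ∈ D, m u ∈ D)
    {p q : V} (hp : p ∈ C) (hpD : p ∈ D) (h : Link G m C D p q) : Link G m C D q p := by
  obtain ⟨hqC, hqD, hqp, hqmp, z, hz, hadj⟩ := h
  obtain ⟨a1, a2, a3, a4⟩ := hmatch q (hCS hqC)
  obtain ⟨hzC, hzD⟩ := reach_mem hmatch hCS hCm hDm hp hz
  have hpq : p ≠ m q := by grind
  have hmqD := hDm' q hqD
  refine ⟨hp, hpD, hqp.symm, hpq, ?_⟩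
  exact reach_rev hmatch hCS hCm hDm hp hqC hz q Reach.base hadj.symm (by grind)

end Chains

end Helpers

set_option maxHeartbeats 2000000 in
theorem at_most_two_D_pairs {V : Type*} [Fintype V] [DecidableEq V]
    (G : SimpleGraph V) [DecidableRel G.Adj] (S : Finset V) (m : V → V)
    (hconn : G.Connected)
    (hcubic : ∀ v : V, G.degree v = 3)
    (hdom : ∀ v : V, v ∉ S → ∃ u ∈ S, G.Adj v u)
    (hmatch : IsMatchingOn G S m)
    (hmincard : ∀ T : Finset V, IsPDS G T → S.card ≤ T.card)
    (hP1 : ∀ T : Finset V, IsPDS G T → T.card = S.card → lambdaS G S ≤ lambdaS G T)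
    (hP2 : ∀ (T : Finset V) (m' : V → V),
        (∀ v : V, v ∉ T → ∃ u ∈ T, G.Adj v u) → IsMatchingOn G T m' →
        T.card = S.card → lambdaS G T = lambdaS G S →
        (setA G S m ∪ setB G S m).card ≤ (setA G T m' ∪ setB G T m').card) :
    ∀ C : Finset V, IsComponent G S C → NoLinkedDPairs G S m C →
      (¬ ∃ u ∈ C, IsBCPair G S m u) →
      (C ∩ setD G S m).card ≤ 4 := by
  intro C hC hN hBC
  obtain ⟨hCS, -, hCconn, hCcl⟩ := hC
  set D := setD G S m with hD
  have memD : ∀ d, d ∈ D ↔ d ∈ S ∧ privates G S d = ∅ ∧ privates G S (m d) = ∅ := by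
    intro d; simp [hD, setD]
  have hCm : ∀ u ∈ C, m u ∈ C := by
    intro u hu
    obtain ⟨h1, -, h3, -⟩ := hmatch u (hCS hu)
    exact hCcl u hu _ h1 h3
  have hDm' : ∀ u ∈ D, m u ∈ D := by
    intro u hu
    rw [memD] at hu ⊢
    obtain ⟨h1, -, h3, h4⟩ := hmatch u hu.1
    rw [h4]
    exact ⟨h1, hu.2.2, hu.2.1⟩
  have hDm : ∀ u ∈ C, m u ∈ D → u ∈ D := by
    intro u hu h
    have := hDm' _ h
    rwa [(hmatch u (hCS hu)).2.2.2] at this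
  have hNP : ∀ d ∈ D, NoPriv G S d := fun d hd =>
    noPriv_of ((memD d).1 hd).1 ((memD d).1 hd).2.1
  -- every vertex of `C` outside `D` has a private neighbour
  have hpriv : ∀ a ∈ C, a ∉ D → (privates G S a).Nonempty := by
    intro a ha haD
    by_contra hcon
    rw [Finset.not_nonempty_iff_eq_empty] at hcon
    obtain ⟨h1, -, -, h4⟩ := hmatch a (hCS ha)
    have h2 : (privates G S (m a)).Nonempty := by
      rw [Finset.nonempty_iff_ne_empty]
      intro h
      exact haD ((memD a).2 ⟨hCS ha, hcon, h⟩)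
    have hB : m a ∈ setB G S m := by
      simp only [setB, Finset.mem_filter, h4]
      exact ⟨h1, h2, hcon⟩
    exact hBC ⟨a, ha, Or.inr ⟨by simp only [setC, Finset.mem_filter]; exact ⟨hCS ha, hB⟩, hB⟩⟩
  have hA : ∀ a ∈ C, a ∉ D → ∀ y₁ ∈ S, ∀ y₂ ∈ S, G.Adj a y₁ → G.Adj a y₂ → y₁ ≠ m a →
      y₂ ≠ m a → y₁ = y₂ := by
    intro a ha haD y₁ hy₁ y₂ hy₂ h1 h2 h3 h4
    obtain ⟨x, hx⟩ := hpriv a ha haD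
    simp only [privates, Finset.mem_filter, Finset.mem_univ, true_and] at hx
    have hxa : G.Adj x a := by
      have : a ∈ nbrS G S x := by rw [hx.2]; simp
      exact (mem_nbrS.1 this).2
    obtain ⟨k1, -, k3, -⟩ := hmatch a (hCS ha)
    have hxS := hx.1
    have := cubic_three hcubic k3 h1 hxa.symm h2 h3.symm (by grind) (by grind)
    grind
  have LM := fun {p q : V} (hp : p ∈ C) (hpD : p ∈ D) (h : Link G m C D p q) =>
    link_matching hmatch hCS hCm hDm hDm' hA hN hp hpD h
  have LS := fun {p q : V} (hp : p ∈ C) (hpD : p ∈ D) (h : Link G m C D p q) =>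
    link_symm hmatch hCS hCm hDm hDm' hp hpD h
  -- the outside vertex attached to a link
  have LX : ∀ p ∈ C, p ∈ D → ∀ q, Link G m C D p q → ∃ x, x ∉ S ∧ G.Adj x (m p) ∧
      G.Adj x (m q) ∧ ∀ s ∈ S, G.Adj x s → s = m p ∨ s = m q := by
    intro p hp hpD q h
    obtain ⟨⟨m', hm', -⟩, -⟩ := LM hp hpD h
    obtain ⟨hqC, hqD, hqp, hqmp, -⟩ := h
    obtain ⟨a1, a2, a3, a4⟩ := hmatch p (hCS hp)
    obtain ⟨b1, b2, b3, b4⟩ := hmatch q (hCS hqC)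
    have hpS := hCS hp
    have hqS := hCS hqC
    exact pair_removal hdom hmincard a1 (hNP _ (hDm' _ hpD)) (hNP _ (hDm' _ hqD)) hm'
      (a' := p) (b' := q) (by grind) a3.symm (by grind) b3.symm
  -- a vertex on a link has a neighbour outside `D`
  have LN : ∀ p ∈ C, p ∈ D → ∀ q, Link G m C D p q → ∃ z ∈ C, z ∉ D ∧ G.Adj q z := by
    intro p hp hpD q h
    obtain ⟨-, z, h1, h2, -, h3⟩ := LM hp hpD h
    exact ⟨z, h1, h2, h3⟩
  have K1 : ∀ v ∈ C, v ∈ D → ∀ p r, Link G m C D v p → Link G m C D v r → r = p ∨ r = m p := by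
    intro v hv hvD p r hp hr
    by_contra hcon
    push Not at hcon
    obtain ⟨hrp, hrmp⟩ := hcon
    obtain ⟨⟨m₁, hm₁, hf₁⟩, a, haC, haD, -, hpa⟩ := LM hv hvD hp
    obtain ⟨⟨m₂, hm₂, hf₂⟩, b, hbC, hbD, -, hrb⟩ := LM hv hvD hr
    obtain ⟨x₁, hx₁, hx₁v, hx₁p, hx₁'⟩ := LX v hv hvD p hp
    obtain ⟨x₂, hx₂, hx₂v, hx₂r, hx₂'⟩ := LX v hv hvD r hr
    obtain ⟨hpC, hpD, hpv, hpmv, -⟩ := hp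
    obtain ⟨hrC, hrD, hrv, hrmv, -⟩ := hr
    have hmp := hDm' p hpD
    have hmr := hDm' r hrD
    have hmv := hDm' v hvD
    have e1 : p ≠ m r := by
      intro h
      have := (hmatch r (hCS hrC)).2.2.2
      grind
    exact case_one hcubic hdom hmatch hmincard hP1 (hCS hv) (hCS hpC) (hCS hrC) hpv hpmv hrv hrmv
      hrp hrmp (hNP _ hpD) (hNP _ hmp) (hNP _ hrD) (hNP _ hmr) hm₁ (hf₁ r hrD hrv hrmv hrp hrmp)
      hm₂ (hf₂ p hpD hpv hpmv hrp.symm e1) (hCS haC) hpa (by grind) (by grind) (by grind)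
      (hCS hbC) hrb (by grind) (by grind) hx₁ hx₂ hx₁p hx₁v hx₁' hx₂r hx₂v hx₂'
  have K2 : ∀ v ∈ C, v ∈ D → ∀ p r, Link G m C D v p → Link G m C D (m v) r → False := by
    intro v hv hvD p r hp hr
    have hmvD := hDm' v hvD
    have hmvC := hCm v hv
    obtain ⟨v1, v2, v3, v4⟩ := hmatch v (hCS hv)
    obtain ⟨x₁, hx₁, hx₁v, hx₁p, -⟩ := LX v hv hvD p hp
    obtain ⟨x₂, hx₂, hx₂v, hx₂r, -⟩ := LX (m v) hmvC hmvD r hr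
    rw [v4] at hx₂v
    obtain ⟨a, haC, haD, hva⟩ := LN p hp.1 hp.2.1 v (LS hv hvD hp)
    obtain ⟨b, hbC, hbD, hvb⟩ := LN r hr.1 hr.2.1 (m v) (LS hmvC hmvD hr)
    obtain ⟨hpC, hpD, hpv, hpmv, -⟩ := hp
    obtain ⟨hrC, hrD, hrv, hrmv, -⟩ := hr
    rw [v4] at hrmv
    obtain ⟨p1, p2, p3, p4⟩ := hmatch p (hCS hpC)
    obtain ⟨r1, r2, r3, r4⟩ := hmatch r (hCS hrC)
    exact case_two hcubic hdom hmatch hmincard (hCS hv) (hCS haC) (hCS hbC) hva (by grind) hvb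
      (by grind) hx₁ hx₁v p1 hx₁p (by grind) (by grind) hx₂ hx₂v r1 hx₂r (by grind) (by grind)
  -- each pair is linked to at most one other pair
  have K : ∀ v ∈ C, v ∈ D → ∀ v₁ v₂, (v₁ = v ∨ v₁ = m v) → (v₂ = v ∨ v₂ = m v) → ∀ p r,
      Link G m C D v₁ p → Link G m C D v₂ r → r = p ∨ r = m p := by
    intro v hv hvD v₁ v₂ h1 h2 p r hp hr
    rcases h1 with rfl | rfl <;> rcases h2 with rfl | rfl
    · exact K1 _ hv hvD p r hp hr
    · exact (K2 _ hv hvD p r hp hr).elim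
    · exact (K2 _ hv hvD r p hr hp).elim
    · exact K1 _ (hCm _ hv) (hDm' _ hvD) p r hp hr
  -- the closure argument
  have main : ∀ T : Finset V, T.Nonempty → T ⊆ C ∩ D → (∀ t ∈ T, m t ∈ T) →
      (∀ t ∈ T, ∀ y, Link G m C D t y → y ∈ T) → C ∩ D ⊆ T := by
    intro T hTne hTCD hTm hTL
    have hall : ∀ x : (↑C : Set V), ∃ t ∈ T, Reach G m C D t x.1 ∨ Reach G m C D t (m x.1) := by
      obtain ⟨t₀, ht₀⟩ := hTne
      have ht₀C : t₀ ∈ C := (Finset.mem_inter.1 (hTCD ht₀)).1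
      intro x
      have hr : (G.induce (↑C : Set V)).Reachable ⟨t₀, ht₀C⟩ x := hCconn.preconnected _ _
      rw [SimpleGraph.reachable_iff_reflTransGen] at hr
      induction hr with
      | refl => exact ⟨t₀, ht₀, Or.inl Reach.base⟩
      | @tail x y _ hxy ih =>
        obtain ⟨x, hxC⟩ := x
        obtain ⟨y, hyC⟩ := y
        have hxC' : x ∈ C := hxC
        have hyC' : y ∈ C := hyC
        have hadj : G.Adj x y := hxy
        obtain ⟨x1, x2, x3, x4⟩ := hmatch x (hCS hxC')
        obtain ⟨y1, y2, y3, y4⟩ := hmatch y (hCS hyC')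
        have first : ∀ t ∈ T, Reach G m C D t x →
            ∃ t ∈ T, Reach G m C D t y ∨ Reach G m C D t (m y) := by
          intro t ht hx
          by_cases h1 : y = m x
          · refine ⟨t, ht, Or.inr ?_⟩
            rw [h1, x4]
            exact hx
          by_cases hyD : y ∈ D
          · by_cases h2 : y = t
            · exact ⟨y, h2 ▸ ht, Or.inl Reach.base⟩
            by_cases h3 : y = m t
            · exact ⟨y, h3 ▸ hTm t ht, Or.inl Reach.base⟩
            exact ⟨y, hTL t ht y ⟨hyC', hyD, h2, h3, x, hx, hadj⟩, Or.inl Reach.base⟩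
          · exact ⟨t, ht, Or.inr (Reach.step hx hyC' hyD hadj h1)⟩
        obtain ⟨t, ht, hx | hx⟩ := ih
        · exact first t ht hx
        · change Reach G m C D t (m x) at hx
          generalize hw : m x = w at hx
          cases hx with
          | base =>
            have : x = m t := by rw [← hw, x4]
            exact first x (this ▸ hTm t ht) Reach.base
          | @step z a hz haC haD hza hne =>
            have hax : a = x := by
              have := (hmatch a (hCS haC)).2.2.2
              rw [← this, ← hw, x4]
            subst hax
            by_cases h1 : y = m a
            · subst h1
              exact ⟨t, ht, Or.inl (Reach.step hz haC haD hza hne)⟩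
            · have hzC := (reach_mem hmatch hCS hCm hDm
                (Finset.mem_inter.1 (hTCD ht)).1 hz).1
              obtain ⟨z1, z2, z3, z4⟩ := hmatch z (hCS hzC)
              have : y = z := hA a haC haD y (hCS hyC') z (hCS hzC) hadj hza.symm h1
                (by intro h; exact hne (by rw [h]; exact x4.symm))
              subst this
              exact ⟨t, ht, Or.inl hz⟩
    intro d hd
    rw [Finset.mem_inter] at hd
    obtain ⟨t, ht, h | h⟩ := hall ⟨d, hd.1⟩
    · have := (reach_mem hmatch hCS hCm hDm (Finset.mem_inter.1 (hTCD ht)).1 h).2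
      rcases this with h1 | h1
      · have h2 : d = t := h1
        exact h2 ▸ ht
      · exact absurd hd.2 h1
    · have := (reach_mem hmatch hCS hCm hDm (Finset.mem_inter.1 (hTCD ht)).1 h).2
      rcases this with h1 | h1
      · have h2 : d = m t := by rw [← h1]; exact ((hmatch d (hCS hd.1)).2.2.2).symm
        exact h2 ▸ hTm t ht
      · exact absurd (hDm' d hd.2) h1
  rcases Finset.eq_empty_or_nonempty (C ∩ D) with he | ⟨p, hp⟩
  · simp [he]
  rw [Finset.mem_inter] at hp
  obtain ⟨hpC, hpD⟩ := hp
  have p4 := (hmatch p (hCS hpC)).2.2.2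
  have hmpC := hCm p hpC
  have hmpD := hDm' p hpD
  by_cases hlink : ∃ v₁ q, (v₁ = p ∨ v₁ = m p) ∧ Link G m C D v₁ q
  · obtain ⟨v₁, q, hv₁, hq⟩ := hlink
    have hqC := hq.1
    have hqD := hq.2.1
    have q4 := (hmatch q (hCS hqC)).2.2.2
    have hmqC := hCm q hqC
    have hmqD := hDm' q hqD
    have hv₁CD : v₁ ∈ C ∧ v₁ ∈ D := by rcases hv₁ with rfl | rfl <;> exact ⟨‹_›, ‹_›⟩
    have hq' := LS hv₁CD.1 hv₁CD.2 hq
    have hsub := main {p, m p, q, m q} ⟨p, by simp⟩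
      (by intro t; simp only [Finset.mem_insert, Finset.mem_singleton, Finset.mem_inter]; grind)
      (by intro t; simp only [Finset.mem_insert, Finset.mem_singleton]; grind)
      (by
        intro t ht y hy
        simp only [Finset.mem_insert, Finset.mem_singleton] at ht ⊢
        have ht' : (t = p ∨ t = m p) ∨ (t = q ∨ t = m q) := by tauto
        rcases ht' with ht' | ht'
        · have := K p hpC hpD v₁ t hv₁ ht' q y hq hy
          tauto
        · have := K q hqC hqD q t (Or.inl rfl) ht' v₁ y hq' hy
          grind)
    exact le_trans (Finset.card_le_card hsub) Finset.card_le_four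
  · have hsub := main {p, m p} ⟨p, by simp⟩
      (by intro t; simp only [Finset.mem_insert, Finset.mem_singleton, Finset.mem_inter]; grind)
      (by intro t; simp only [Finset.mem_insert, Finset.mem_singleton]; grind)
      (by
        intro t ht y hy
        simp only [Finset.mem_insert, Finset.mem_singleton] at ht
        exact (hlink ⟨t, y, ht, hy⟩).elim)
    exact le_trans (Finset.card_le_card hsub) (le_trans Finset.card_le_two (by norm_num))
end

section
/- Under the stated setup, let S_u and S_v be distinct D-pairs with uv ∈ E(G). If ū has a neighbor t ∈ V∖S which has a neighbor w ∈ (B∪D)∖(S_u∪S_v), then there exists a vertex t₁ ∈ V∖S such that N_S(t₁) = {u, w̄}. -/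
open Finset

lemma nbrS_pair_aux {V : Type*} [Fintype V] [DecidableEq V]
    (G : SimpleGraph V) [DecidableRel G.Adj] (S : Finset V)
    (hdom : ∀ v : V, v ∉ S → ∃ u ∈ S, G.Adj v u) (a b x : V)
    (ha : privates G S a = ∅) (hb : privates G S b = ∅) (hx : x ∉ S)
    (hsub : ∀ z ∈ S, G.Adj x z → z = a ∨ z = b) : nbrS G S x = {a, b} := by
  have hpa : nbrS G S x ≠ {a} := by
    intro h
    have : x ∈ privates G S a := by simp [privates, hx, h]
    simp [ha] at this
  have hpb : nbrS G S x ≠ {b} := by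
    intro h
    have : x ∈ privates G S b := by simp [privates, hx, h]
    simp [hb] at this
  have hs : nbrS G S x ⊆ {a, b} := by
    intro z hz
    simp only [nbrS, mem_filter] at hz
    simpa using hsub z hz.1 hz.2
  have hne : nbrS G S x ≠ ∅ := by
    obtain ⟨z, hz, hz'⟩ := hdom x hx
    exact Finset.ne_empty_of_mem (a := z) (by simp [nbrS, hz, hz'])
  have h4 : nbrS G S x = ∅ ∨ nbrS G S x = {a} ∨ nbrS G S x = {b} ∨ nbrS G S x = {a, b} := by
    rw [← Finset.coe_subset] at hs
    simp only [Finset.coe_insert, Finset.coe_singleton, Set.subset_pair_iff_eq] at hs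
    exact_mod_cast hs
  rcases h4 with h | h | h | h
  · exact absurd h hne
  · exact absurd h hpa
  · exact absurd h hpb
  · exact h

theorem linked_D_pairs_bar_neighbor {V : Type*} [Fintype V] [DecidableEq V]
    (G : SimpleGraph V) [DecidableRel G.Adj] (S : Finset V) (m : V → V)
    (hconn : G.Connected)
    (hcubic : ∀ v : V, G.degree v = 3)
    (hdom : ∀ v : V, v ∉ S → ∃ u ∈ S, G.Adj v u)
    (hmatch : IsMatchingOn G S m)
    (hmincard : ∀ T : Finset V, IsPDS G T → S.card ≤ T.card)
    (hP1 : ∀ T : Finset V, IsPDS G T → T.card = S.card → lambdaS G S ≤ lambdaS G T)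
    (hP2 : ∀ (T : Finset V) (m' : V → V),
        (∀ v : V, v ∉ T → ∃ u ∈ T, G.Adj v u) → IsMatchingOn G T m' →
        T.card = S.card → lambdaS G T = lambdaS G S →
        (setA G S m ∪ setB G S m).card ≤ (setA G T m' ∪ setB G T m').card) :
    ∀ u v t w : V,
      IsDPair G S m u → IsDPair G S m v → v ≠ u → v ≠ m u → G.Adj u v →
      t ∉ S → G.Adj (m u) t → G.Adj t w →
      w ∈ setB G S m ∪ setD G S m →
      w ≠ u → w ≠ m u → w ≠ v → w ≠ m v →
      ∃ t₁ : V, t₁ ∉ S ∧ nbrS G S t₁ = {u, m w} := by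
  intro u v t w hu hv hvu hvmu huv htS hut htw hw hwu hwmu hwv hwmv
  have huD := hu.1
  have hvD := hv.1
  simp only [setD, mem_filter] at huD hvD
  obtain ⟨huS, hpu, hpmu⟩ := huD
  obtain ⟨hvS, hpv, hpmv⟩ := hvD
  have hwS : w ∈ S ∧ privates G S (m w) = ∅ := by
    simp only [setB, setD, mem_union, mem_filter] at hw
    tauto
  obtain ⟨hwS, hpmw⟩ := hwS
  obtain ⟨hmuS, hmune, hmuadj, hmmu⟩ := hmatch u huS
  obtain ⟨hmvS, hmvne, hmvadj, hmmv⟩ := hmatch v hvS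
  obtain ⟨hmwS, hmwne, hmwadj, hmmw⟩ := hmatch w hwS
  have hinj : ∀ a ∈ S, ∀ b ∈ S, m a = m b → a = b := by
    intro a ha b hb h
    rw [← (hmatch a ha).2.2.2, h, (hmatch b hb).2.2.2]
  -- first exchange: a vertex whose neighbourhood in `S` is the two bars
  obtain ⟨y, hyS, hy⟩ : ∃ y, y ∉ S ∧ nbrS G S y = {m u, m v} := by
    by_contra hno
    push Not at hno
    have hpds : IsPDS G (S \ {m u, m v}) := by
      constructor
      · intro x hx
        by_cases hxS : x ∈ S
        · have : x = m u ∨ x = m v := by simp [hxS] at hx; tauto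
          rcases this with rfl | rfl
          · exact ⟨u, by simp; grind, hmuadj.symm⟩
          · exact ⟨v, by simp; grind, hmvadj.symm⟩
        · by_contra hc
          push Not at hc
          refine hno x hxS (nbrS_pair_aux G S hdom _ _ x hpmu hpmv hxS ?_)
          intro z hz hxz
          by_contra hzz
          exact hc z (by simp; tauto) hxz
      · refine ⟨fun z => if z = u then v else if z = v then u else m z, ?_⟩
        intro z hz
        simp only [mem_sdiff, mem_insert, mem_singleton, not_or] at hz
        have hmz := hmatch z hz.1
        have := huv.symm
        simp only [mem_sdiff, mem_insert, mem_singleton, not_or]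
        grind
    have h1 := hmincard _ hpds
    have h2 : (S \ {m u, m v}).card < S.card :=
      Finset.card_lt_card (Finset.sdiff_ssubset (by simp [insert_subset_iff, hmuS, hmvS]) (by simp))
    omega
  have hyadj : ∀ z, (z ∈ S ∧ G.Adj y z) ↔ (z = m u ∨ z = m v) := by
    intro z
    have : z ∈ nbrS G S y ↔ z ∈ ({m u, m v} : Finset V) := by rw [hy]
    simpa [nbrS] using this
  have hyt : y ≠ t := by
    rintro rfl
    have := (hyadj w).1 ⟨hwS, htw⟩
    tauto
  -- neighbours of `m u`
  have hN : ∀ z, G.Adj (m u) z → z = u ∨ z = t ∨ z = y := by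
    have hsub : ({u, t, y} : Finset V) ⊆ G.neighborFinset (m u) := by
      intro z hz
      simp only [mem_insert, mem_singleton] at hz
      rw [SimpleGraph.mem_neighborFinset]
      rcases hz with rfl | rfl | rfl
      · exact hmuadj.symm
      · exact hut
      · exact ((hyadj (m u)).2 (Or.inl rfl)).2.symm
    have hcard : ({u, t, y} : Finset V).card = 3 := by
      rw [Finset.card_eq_three]
      exact ⟨u, t, y, by grind, by grind, hyt.symm, rfl⟩
    have heq := Finset.eq_of_subset_of_card_le hsub
      (by rw [SimpleGraph.card_neighborFinset_eq_degree, hcubic, hcard])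
    intro z hz
    have : z ∈ ({u, t, y} : Finset V) := by
      rw [heq, SimpleGraph.mem_neighborFinset]; exact hz
    simpa using this
  -- second exchange
  by_contra hno
  push Not at hno
  have hmwu : m w ≠ u := by grind
  have hmwmu : m w ≠ m u := by grind
  have hmwv : m w ≠ v := by grind
  have hpds : IsPDS G (insert t (S \ {u, m u, m w})) := by
    constructor
    · intro x hx
      have hxt : x ≠ t := by rintro rfl; simp at hx
      by_cases hxS : x ∈ S
      · have : x = u ∨ x = m u ∨ x = m w := by simp [hxS, hxt] at hx; tauto
        rcases this with rfl | rfl | rfl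
        · exact ⟨v, by simp; grind, huv⟩
        · exact ⟨t, by simp, hut⟩
        · exact ⟨w, by simp; grind, hmwadj.symm⟩
      · by_contra hc
        push Not at hc
        refine hno x hxS (nbrS_pair_aux G S hdom _ _ x hpu hpmw hxS ?_)
        intro z hz hxz
        by_contra hzz
        have hzmu : z = m u := by
          by_contra hzmu
          exact hc z (by simp; tauto) hxz
        subst hzmu
        rcases hN x hxz.symm with rfl | rfl | rfl
        · exact hxS huS
        · exact hxt rfl
        · refine hc (m v) ?_ ((hyadj (m v)).2 (Or.inr rfl)).2
          simp only [mem_insert, mem_sdiff, mem_singleton]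
          grind
    · refine ⟨fun z => if z = t then w else if z = w then t else m z, ?_⟩
      intro z hz
      simp only [mem_insert, mem_sdiff, mem_singleton, not_or] at hz
      have := htw.symm
      have hmz := fun h : z ∈ S => hmatch z h
      simp only [mem_insert, mem_sdiff, mem_singleton, not_or]
      clear hno hN hyadj hy hdom hP1 hP2 hmincard hconn hcubic hmatch hw hu hv hpu hpmu hpv hpmv hpmw
      by_cases h1 : z = t
      · subst h1
        have hwz : w ≠ z := htw.ne'
        simp [hwz, hwS, hwu, hwmu, htw, Ne.symm hmwne]
      · by_cases h2 : z = w
        · subst h2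
          simp [h1, htw.symm, htw.ne]
        · have hzS : z ∈ S := by tauto
          have hmz := hmz hzS
          have h3 : m z ≠ t := fun h => htS (h ▸ hmz.1)
          have h4 : m z ≠ w := by grind
          simp only [h1, h2, h3, h4, if_false]
          grind
  have h1 := hmincard _ hpds
  have h3 : ({u, m u, m w} : Finset V).card = 3 := by
    rw [Finset.card_eq_three]
    exact ⟨u, m u, m w, hmune.symm, hmwu.symm, hmwmu.symm, rfl⟩
  have h2 := Finset.card_sdiff_add_card_eq_card
    (show ({u, m u, m w} : Finset V) ⊆ S by simp [insert_subset_iff, huS, hmuS, hmwS])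
  have h4 := Finset.card_insert_le t (S \ {u, m u, m w})
  omega
end

section
/- Under the stated setup, let S_u be a solo D-pair such that u and ū have no common neighbor in V∖S. Then it is impossible that, among the four edges between S_u and V∖S, three have f-weight 1/3 and the remaining one has f-weight 5/12. -/
open Finset

/-- The combinatorial configuration: `Q p v t` says that the outside vertex `p` has trace
`{v, t}` on `S ∖ {u, m u}`. -/
structure Cfg {V : Type*} (Q : V → V → V → Prop) (m : V → V) (D : V → Prop)
    (x y z w a₁ a₂ a₃ a₄ b₁ b₂ b₃ c : V) : Prop where
  hsym : ∀ p v t, Q p v t → Q p t v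
  hfun : ∀ p v t t', Q p v t → Q p v t' → t = t'
  hK : ∀ p q r v t t' t'', Q p v t → Q q v t' → Q r v t'' → p = q ∨ p = r ∨ q = r
  hne : ∀ p v t, Q p v t → v ≠ t
  hD : ∀ v, D v → D (m v) ∧ m v ≠ v ∧ m (m v) = v
  hxy : x ≠ y
  hxz : x ≠ z
  hxw : x ≠ w
  hyz : y ≠ z
  hyw : y ≠ w
  hzw : z ≠ w
  qx : Q x a₁ a₂
  qy : Q y a₃ a₄
  qz : Q z b₁ b₂
  qw : Q w b₃ c
  ha₁ : D a₁
  ha₂ : D a₂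
  ha₃ : D a₃
  ha₄ : D a₄
  hb₁ : D b₁
  hb₂ : D b₂
  hb₃ : D b₃
  hc : ¬ D c
  hR : ∀ a b, (a = a₁ ∨ a = a₂ ∨ a = a₃ ∨ a = a₄) → (b = b₁ ∨ b = b₂ ∨ b = b₃) →
      a ≠ b → m a ≠ b → ∃ p, Q p (m a) (m b)

namespace Cfg

variable {V : Type*} {Q : V → V → V → Prop} {m : V → V} {D : V → Prop}
    {x y z w a₁ a₂ a₃ a₄ b₁ b₂ b₃ c : V}

theorem swapA (h : Cfg Q m D x y z w a₁ a₂ a₃ a₄ b₁ b₂ b₃ c) :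
    Cfg Q m D x y z w a₂ a₁ a₃ a₄ b₁ b₂ b₃ c :=
  { h with
    qx := h.hsym _ _ _ h.qx
    ha₁ := h.ha₂
    ha₂ := h.ha₁
    hR := fun a b ha hb => h.hR a b (by tauto) hb }

theorem swapB (h : Cfg Q m D x y z w a₁ a₂ a₃ a₄ b₁ b₂ b₃ c) :
    Cfg Q m D x y z w a₁ a₂ a₃ a₄ b₂ b₁ b₃ c :=
  { h with
    qz := h.hsym _ _ _ h.qz
    hb₁ := h.hb₂
    hb₂ := h.hb₁
    hR := fun a b ha hb => h.hR a b ha (by tauto) }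

theorem swapXY (h : Cfg Q m D x y z w a₁ a₂ a₃ a₄ b₁ b₂ b₃ c) :
    Cfg Q m D y x z w a₃ a₄ a₁ a₂ b₁ b₂ b₃ c :=
  { h with
    hxy := h.hxy.symm
    hxz := h.hyz
    hxw := h.hyw
    hyz := h.hxz
    hyw := h.hxw
    qx := h.qy
    qy := h.qx
    ha₁ := h.ha₃
    ha₂ := h.ha₄
    ha₃ := h.ha₁
    ha₄ := h.ha₂
    hR := fun a b ha hb => h.hR a b (by tauto) hb }

/-- Three partners of the same vertex cannot be pairwise distinct. -/
theorem L1 (h : Cfg Q m D x y z w a₁ a₂ a₃ a₄ b₁ b₂ b₃ c) :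
    ∀ v t t' t'', (∃ p, Q p v t) → (∃ p, Q p v t') → (∃ p, Q p v t'') →
      t = t' ∨ t = t'' ∨ t' = t'' := by
  rintro v t t' t'' ⟨p, hp⟩ ⟨q, hq⟩ ⟨r, hr⟩
  rcases h.hK p q r v t t' t'' hp hq hr with h' | h' | h'
  · subst h'; left; exact h.hfun _ _ _ _ hp hq
  · subst h'; right; left; exact h.hfun _ _ _ _ hp hr
  · subst h'; right; right; exact h.hfun _ _ _ _ hq hr

/-- Two different outside neighbours determine all partners. -/
theorem L2 (h : Cfg Q m D x y z w a₁ a₂ a₃ a₄ b₁ b₂ b₃ c) :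
    ∀ p q v t t' t'', p ≠ q → Q p v t → Q q v t' → (∃ r, Q r v t'') →
      t'' = t ∨ t'' = t' := by
  rintro p q v t t' t'' hpq hp hq ⟨r, hr⟩
  rcases h.hK p q r v t t' t'' hp hq hr with h' | h' | h'
  · exact absurd h' hpq
  · subst h'; left; exact h.hfun _ _ _ _ hr hp
  · subst h'; right; exact h.hfun _ _ _ _ hr hq

theorem inj (h : Cfg Q m D x y z w a₁ a₂ a₃ a₄ b₁ b₂ b₃ c) {v t : V} (hv : D v) (ht : D t)
    (e : m v = m t) : v = t := by
  rw [← (h.hD v hv).2.2, ← (h.hD t ht).2.2, e]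

theorem claim1_aux (h : Cfg Q m D x y z w a₁ a₂ a₃ a₄ b₁ b₂ b₃ c) (e : a₂ = m a₁)
    (e' : b₁ = a₁) : False := by
  subst e e'
  obtain ⟨D1, n1, i1⟩ := h.hD _ h.ha₁
  obtain ⟨E2, k2, j2⟩ := h.hD _ h.hb₂
  have s2 := h.hne _ _ _ h.qz
  have e2 : b₂ = m b₁ := by
    by_contra hn
    have R := h.hR (m b₁) b₂ (by tauto) (by tauto) (Ne.symm hn) (by rw [i1]; exact s2)
    rw [i1] at R
    rcases h.L2 _ _ _ _ _ _ h.hxz h.qx h.qz R with h' | h'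
    · exact s2 (h.inj h.ha₁ h.hb₂ h'.symm)
    · exact k2 h'
  subst e2
  by_cases c1 : b₃ = b₁
  · subst c1
    rcases h.hK _ _ _ _ _ _ _ h.qx h.qz h.qw with h' | h' | h'
    exacts [h.hxz h', h.hxw h', h.hzw h']
  by_cases c2 : b₃ = m b₁
  · subst c2
    rcases h.hK _ _ _ _ _ _ _ (h.hsym _ _ _ h.qx) (h.hsym _ _ _ h.qz) h.qw with h' | h' | h'
    exacts [h.hxz h', h.hxw h', h.hzw h']
  have R := h.hR (m b₁) b₃ (by tauto) (by tauto) (Ne.symm c2) (by rw [i1]; exact Ne.symm c1)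
  rw [i1] at R
  rcases h.L2 _ _ _ _ _ _ h.hxz h.qx h.qz R with h' | h' <;>
    exact c1 (h.inj h.hb₃ h.ha₁ h')

theorem claim1 (h : Cfg Q m D x y z w a₁ a₂ a₃ a₄ b₁ b₂ b₃ c) : a₂ ≠ m a₁ := by
  intro e
  obtain ⟨D1, n1, i1⟩ := h.hD _ h.ha₁
  have e' : a₁ = m a₂ := by rw [e, i1]
  by_cases c1 : b₁ = a₁
  · exact h.claim1_aux e c1
  by_cases c2 : b₂ = a₁
  · exact h.swapB.claim1_aux e c2
  by_cases c3 : b₁ = a₂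
  · exact h.swapA.claim1_aux e' c3
  by_cases c4 : b₂ = a₂
  · exact h.swapB.swapA.claim1_aux e' c4
  have R1 := h.hR a₂ b₁ (by tauto) (by tauto) (Ne.symm c3) (by rw [← e']; exact Ne.symm c1)
  have R2 := h.hR a₂ b₂ (by tauto) (by tauto) (Ne.symm c4) (by rw [← e']; exact Ne.symm c2)
  rw [← e'] at R1 R2
  have s2 := h.hne _ _ _ h.qz
  rcases h.L1 _ _ _ _ ⟨_, h.qx⟩ R1 R2 with h' | h' | h'
  · exact c1 (h.inj h.hb₁ h.ha₁ (by rw [← h', e]))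
  · exact c2 (h.inj h.hb₂ h.ha₁ (by rw [← h', e]))
  · exact s2 (h.inj h.hb₁ h.hb₂ h')

def Sep (m : V → V) (v t : V) : Prop := v ≠ t ∧ v ≠ m t ∧ m v ≠ t ∧ m v ≠ m t

theorem sepA (h : Cfg Q m D x y z w a₁ a₂ a₃ a₄ b₁ b₂ b₃ c) : Sep m a₁ a₂ :=
  ⟨h.hne _ _ _ h.qx, h.swapA.claim1, h.claim1.symm,
    fun e => h.hne _ _ _ h.qx (h.inj h.ha₁ h.ha₂ e)⟩

theorem mkSep (h : Cfg Q m D x y z w a₁ a₂ a₃ a₄ b₁ b₂ b₃ c) {v t : V} (hv : D v) (ht : D t)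
    (h1 : v ≠ t) (h2 : v ≠ m t) : Sep m v t :=
  ⟨h1, h2, fun e => h2 (by rw [← e, (h.hD v hv).2.2]), fun e => h1 (h.inj hv ht e)⟩

/-- If `b₁, b₂` are mates then every two members of the first family outside the class agree. -/
theorem claim2_aux (h : Cfg Q m D x y z w a₁ a₂ a₃ a₄ b₁ b₂ b₃ c) (e : b₂ = m b₁) {a a' : V}
    (ha : a = a₁ ∨ a = a₂ ∨ a = a₃ ∨ a = a₄) (ha' : a' = a₁ ∨ a' = a₂ ∨ a' = a₃ ∨ a' = a₄)
    (Da : D a) (Da' : D a')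
    (s : Sep m a b₁) (s' : Sep m a' b₁) : a = a' := by
  obtain ⟨E1, k1, j1⟩ := h.hD _ h.hb₁
  have R1 := h.hR a b₁ ha (by tauto) s.1 s.2.2.1
  have R2 := h.hR a' b₁ ha' (by tauto) s'.1 s'.2.2.1
  obtain ⟨p, hp⟩ := R1
  obtain ⟨q, hq⟩ := R2
  rcases h.L1 _ _ _ _ ⟨_, h.hsym _ _ _ (e ▸ h.qz)⟩ ⟨_, h.hsym _ _ _ hp⟩ ⟨_, h.hsym _ _ _ hq⟩
    with h' | h' | h'
  · exact absurd h'.symm s.2.2.1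
  · exact absurd h'.symm s'.2.2.1
  · exact h.inj Da Da' h'

theorem claim2_aux2 (h : Cfg Q m D x y z w a₁ a₂ a₃ a₄ b₁ b₂ b₃ c) (e : b₂ = m b₁)
    (e' : a₁ = b₁) : False := by
  have s := h.sepA
  obtain ⟨E1, k1, j1⟩ := h.hD _ h.hb₁
  obtain ⟨D2, n2, i2⟩ := h.hD _ h.ha₂
  subst e'
  obtain ⟨p, hp⟩ := h.hR a₂ b₂ (by tauto) (by tauto) (by rw [e]; exact s.2.2.1.symm)
    (by rw [e]; exact s.2.2.2.symm)
  rw [e, j1] at hp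
  rcases h.L2 _ _ _ _ _ _ h.hxz h.qx h.qz ⟨_, h.hsym _ _ _ hp⟩ with h' | h'
  · exact n2 h'
  · exact s.2.2.2 (by rw [← e, ← h'])

theorem claim2 (h : Cfg Q m D x y z w a₁ a₂ a₃ a₄ b₁ b₂ b₃ c) : b₂ ≠ m b₁ := by
  intro e
  obtain ⟨E1, k1, j1⟩ := h.hD _ h.hb₁
  have e' : b₁ = m b₂ := by rw [e, j1]
  have c1 : a₁ ≠ b₁ := fun h' => h.claim2_aux2 e h'
  have c2 : a₁ ≠ m b₁ := fun h' => h.swapB.claim2_aux2 e' (by rw [h', e])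
  have c3 : a₂ ≠ b₁ := fun h' => h.swapA.claim2_aux2 e h'
  have c4 : a₂ ≠ m b₁ := fun h' => h.swapA.swapB.claim2_aux2 e' (by rw [h', e])
  exact h.hne _ _ _ h.qx (h.claim2_aux e (by tauto) (by tauto) h.ha₁ h.ha₂
    (h.mkSep h.ha₁ h.hb₁ c1 c2) (h.mkSep h.ha₂ h.hb₁ c3 c4))

theorem sepB (h : Cfg Q m D x y z w a₁ a₂ a₃ a₄ b₁ b₂ b₃ c) : Sep m b₁ b₂ :=
  h.mkSep h.hb₁ h.hb₂ (h.hne _ _ _ h.qz) h.swapB.claim2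

/-- `hR` for separated vertices. -/
theorem rel (h : Cfg Q m D x y z w a₁ a₂ a₃ a₄ b₁ b₂ b₃ c) {a b : V}
    (ha : a = a₁ ∨ a = a₂ ∨ a = a₃ ∨ a = a₄) (hb : b = b₁ ∨ b = b₂ ∨ b = b₃) (s : Sep m a b) :
    (∃ p, Q p (m a) (m b)) ∧ ∃ p, Q p (m b) (m a) := by
  obtain ⟨p, hp⟩ := h.hR a b ha hb s.1 s.2.2.1
  exact ⟨⟨p, hp⟩, ⟨p, h.hsym _ _ _ hp⟩⟩

/-- A vertex cannot lie on three different outside vertices. -/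
theorem K (h : Cfg Q m D x y z w a₁ a₂ a₃ a₄ b₁ b₂ b₃ c) {p q r v t t' t'' : V}
    (hp : Q p v t) (hq : Q q v t') (hr : Q r v t'') (h1 : p ≠ q) (h2 : p ≠ r) (h3 : q ≠ r) :
    False := by
  rcases h.hK _ _ _ _ _ _ _ hp hq hr with h' | h' | h'
  exacts [h1 h', h2 h', h3 h']

theorem cD (h : Cfg Q m D x y z w a₁ a₂ a₃ a₄ b₁ b₂ b₃ c) {v : V} (hv : D v) :
    c ≠ v ∧ c ≠ m v :=
  ⟨fun e => h.hc (e ▸ hv), fun e => h.hc (e ▸ (h.hD v hv).1)⟩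

/-- `b₃` cannot have two further partners in `D`. -/
theorem W (h : Cfg Q m D x y z w a₁ a₂ a₃ a₄ b₁ b₂ b₃ c) {v t t' : V} (e : b₃ = v)
    (h1 : ∃ p, Q p v t) (h2 : ∃ p, Q p v t') (ht : D t) (ht' : D t') (hne : t ≠ t') : False := by
  subst e
  rcases h.L1 _ _ _ _ ⟨_, h.qw⟩ h1 h2 with h' | h' | h'
  · exact (h.cD ht).1 h'
  · exact (h.cD ht').1 h'
  · exact hne h'

theorem Sep.symm {v t : V} (s : Sep m v t) : Sep m t v :=
  ⟨s.1.symm, s.2.2.1.symm, s.2.1.symm, s.2.2.2.symm⟩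

theorem Sep.mr (h : Cfg Q m D x y z w a₁ a₂ a₃ a₄ b₁ b₂ b₃ c) {v t : V} (ht : D t)
    (s : Sep m v t) : Sep m v (m t) :=
  ⟨s.2.1, by rw [(h.hD t ht).2.2]; exact s.1, s.2.2.2, by rw [(h.hD t ht).2.2]; exact s.2.2.1⟩

/-- Case `b₁ = a₁`, `b₂ = a₂`. -/
theorem claim3a (h : Cfg Q m D x y z w a₁ a₂ a₃ a₄ b₁ b₂ b₃ c) (e : b₁ = a₁) (e2 : b₂ = a₂) :
    False := by
  subst e e2
  have s := h.sepA
  obtain ⟨E1, k1, j1⟩ := h.hD _ h.hb₁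
  obtain ⟨E2, k2, j2⟩ := h.hD _ h.hb₂
  have qx' := h.hsym _ _ _ h.qx
  have qz' := h.hsym _ _ _ h.qz
  have o1 : b₃ ≠ b₁ := fun e => h.K h.qx h.qz (e ▸ h.qw) h.hxz h.hxw h.hzw
  have o2 : b₃ ≠ b₂ := fun e => h.K qx' qz' (e ▸ h.qw) h.hxz h.hxw h.hzw
  have o3 : b₃ ≠ m b₁ := by
    intro e
    have R := (h.rel (a := b₂) (b := b₃) (by tauto) (by tauto) (e ▸ s.symm.mr h h.hb₁)).2
    rw [e, j1] at R
    rcases h.L2 _ _ _ _ _ _ h.hxz h.qx h.qz R with h' | h' <;> exact k2 h'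
  have o4 : b₃ ≠ m b₂ := by
    intro e
    have R := (h.rel (a := b₁) (b := b₃) (by tauto) (by tauto) (e ▸ s.mr h h.hb₂)).2
    rw [e, j2] at R
    rcases h.L2 _ _ _ _ _ _ h.hxz qx' qz' R with h' | h' <;> exact k1 h'
  have s31 := h.mkSep h.hb₃ h.hb₁ o1 o3
  have s32 := h.mkSep h.hb₃ h.hb₂ o2 o4
  have R1 := (h.rel (a := b₁) (b := b₂) (by tauto) (by tauto) s).1
  have R2 := (h.rel (a := b₁) (b := b₃) (by tauto) (by tauto) s31.symm).1
  have key : ∀ a a', (a = a₃ ∨ a = a₄) → D a → Q y a a' → a = b₃ := by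
    intro a a' ha Da qy
    have ha' : a = b₁ ∨ a = b₂ ∨ a = a₃ ∨ a = a₄ := by tauto
    have t1 : a ≠ b₁ := fun e => h.K h.qx h.qz (e ▸ qy) h.hxz h.hxy h.hyz.symm
    have t2 : a ≠ b₂ := fun e => h.K qx' qz' (e ▸ qy) h.hxz h.hxy h.hyz.symm
    have t3 : a ≠ m b₁ := by
      intro e
      have R := (h.rel (a := a) (b := b₂) ha' (by tauto) (e ▸ (s.symm.mr h h.hb₁).symm)).1
      rw [e, j1] at R
      rcases h.L2 _ _ _ _ _ _ h.hxz h.qx h.qz R with h' | h' <;> exact k2 h'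
    have t4 : a ≠ m b₂ := by
      intro e
      have R := (h.rel (a := a) (b := b₁) ha' (by tauto) (e ▸ (s.mr h h.hb₂).symm)).1
      rw [e, j2] at R
      rcases h.L2 _ _ _ _ _ _ h.hxz qx' qz' R with h' | h' <;> exact k1 h'
    have R := (h.rel (a := a) (b := b₁) ha' (by tauto) (h.mkSep Da h.hb₁ t1 t3)).2
    rcases h.L1 _ _ _ _ R1 R2 R with h' | h' | h'
    · exact absurd h'.symm s32.2.2.2
    · exact absurd (h.inj h.hb₂ Da h').symm t2
    · exact (h.inj h.hb₃ Da h').symm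
  exact h.hne _ _ _ h.qy ((key a₃ a₄ (by tauto) h.ha₃ h.qy).trans
    (key a₄ a₃ (by tauto) h.ha₄ (h.hsym _ _ _ h.qy)).symm)

/-- Case `b₁ = a₁`, `b₂ = m a₂`. -/
theorem claim3b (h : Cfg Q m D x y z w a₁ a₂ a₃ a₄ b₁ b₂ b₃ c) (e : b₁ = a₁) (e2 : b₂ = m a₂) :
    False := by
  subst e e2
  have s := h.sepA
  obtain ⟨E1, k1, j1⟩ := h.hD _ h.hb₁
  obtain ⟨E2, k2, j2⟩ := h.hD _ h.ha₂
  have R1 := h.rel (a := a₂) (b := b₁) (by tauto) (by tauto) s.symm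
  have R2 := h.rel (a := b₁) (b := m a₂) (by tauto) (by tauto) (s.mr h h.ha₂)
  rw [j2] at R2
  have o1 : b₃ ≠ b₁ := fun e => h.K h.qx h.qz (e ▸ h.qw) h.hxz h.hxw h.hzw
  have o3 : b₃ ≠ m b₁ := fun e => h.W e R1.2 R2.1 E2 h.ha₂ k2
  have s31 := h.mkSep h.hb₃ h.hb₁ o1 o3
  have R3 := h.rel (a := b₁) (b := b₃) (by tauto) (by tauto) s31.symm
  rcases h.L1 _ _ _ _ R1.2 R2.1 R3.1 with h' | h' | h'
  · exact k2 h'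
  · have e := h.inj h.ha₂ h.hb₃ h'
    exact h.W e.symm ⟨_, h.hsym _ _ _ h.qx⟩ R2.2 h.hb₁ E1 k1.symm
  · have e : b₃ = m a₂ := by rw [h', (h.hD _ h.hb₃).2.2]
    exact h.W e ⟨_, h.hsym _ _ _ h.qz⟩ R1.1 h.hb₁ E1 k1.symm

/-- Case `b₁ = a₁` in general. -/
theorem claim3c (h : Cfg Q m D x y z w a₁ a₂ a₃ a₄ b₁ b₂ b₃ c) (e : b₁ = a₁) : False := by
  by_cases c1 : b₂ = a₂
  · exact h.claim3a e c1
  by_cases c2 : b₂ = m a₂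
  · exact h.claim3b e c2
  have s2 := h.mkSep h.hb₂ h.ha₂ c1 c2
  have s := h.sepA
  have s' := h.sepB
  subst e
  obtain ⟨E1, k1, j1⟩ := h.hD _ h.hb₁
  obtain ⟨E2, k2, j2⟩ := h.hD _ h.ha₂
  obtain ⟨E3, k3, j3⟩ := h.hD _ h.hb₂
  have R1 := h.rel (a := a₂) (b := b₁) (by tauto) (by tauto) s.symm
  have R2 := h.rel (a := b₁) (b := b₂) (by tauto) (by tauto) s'
  have o1 : b₃ ≠ b₁ := fun e => h.K h.qx h.qz (e ▸ h.qw) h.hxz h.hxw h.hzw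
  have o3 : b₃ ≠ m b₁ := fun e => h.W e R1.2 R2.1 E2 E3 s2.2.2.2.symm
  have s31 := h.mkSep h.hb₃ h.hb₁ o1 o3
  have R3 := h.rel (a := b₁) (b := b₃) (by tauto) (by tauto) s31.symm
  have key : ∀ a a', (a = a₃ ∨ a = a₄) → D a → Q y a a' → a = a₂ ∨ a = b₂ := by
    intro a a' ha Da qy
    have ha' : a = b₁ ∨ a = a₂ ∨ a = a₃ ∨ a = a₄ := by tauto
    have t1 : a ≠ b₁ := fun e => h.K h.qx h.qz (e ▸ qy) h.hxz h.hxy h.hyz.symm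
    have t3 : a ≠ m b₁ := by
      intro e
      have R := (h.rel (a := a) (b := b₂) ha' (by tauto) (e ▸ (s'.symm.mr h h.hb₁).symm)).1
      rw [e, j1] at R
      rcases h.L2 _ _ _ _ _ _ h.hxz h.qx h.qz R with h' | h'
      · exact s2.2.2.1 h'
      · exact k3 h'
    have R := (h.rel (a := a) (b := b₁) ha' (by tauto) (h.mkSep Da h.hb₁ t1 t3)).2
    rcases h.L1 _ _ _ _ R1.2 R2.1 R with h' | h' | h'
    · exact absurd h'.symm s2.2.2.2
    · exact Or.inl (h.inj h.ha₂ Da h').symm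
    · exact Or.inr (h.inj h.hb₂ Da h').symm
  have q34 := h.hne _ _ _ h.qy
  have qy' := h.hsym _ _ _ h.qy
  have K3 := key a₃ a₄ (by tauto) h.ha₃ h.qy
  have K4 := key a₄ a₃ (by tauto) h.ha₄ qy'
  have ya : ∃ t, Q y a₂ t := by
    rcases K3 with h3 | h3
    · exact ⟨_, h3 ▸ h.qy⟩
    · rcases K4 with h4 | h4
      · exact ⟨_, h4 ▸ qy'⟩
      · exact absurd (h3.trans h4.symm) q34
  have yb : ∃ t, Q y b₂ t := by
    rcases K3 with h3 | h3
    · rcases K4 with h4 | h4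
      · exact absurd (h3.trans h4.symm) q34
      · exact ⟨_, h4 ▸ qy'⟩
    · exact ⟨_, h3 ▸ h.qy⟩
  obtain ⟨t, ya⟩ := ya
  obtain ⟨t', yb⟩ := yb
  rcases h.L1 _ _ _ _ R1.2 R2.1 R3.1 with h' | h' | h'
  · exact s2.2.2.2 h'.symm
  · have e := h.inj h.ha₂ h.hb₃ h'
    exact h.K (h.hsym _ _ _ h.qx) ya (e ▸ h.qw) h.hxy h.hxw h.hyw
  · have e := h.inj h.hb₂ h.hb₃ h'
    exact h.K (h.hsym _ _ _ h.qz) yb (e ▸ h.qw) h.hyz.symm h.hzw h.hyw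

/-- Case `b₁ = m a₁` where moreover `a₃` lies in the class of `a₁`. -/
theorem claim3d (h : Cfg Q m D x y z w a₁ a₂ a₃ a₄ b₁ b₂ b₃ c) (e : b₁ = m a₁)
    (e3 : a₃ = a₁ ∨ a₃ = m a₁) : False := by
  have s := h.sepA
  have s' := h.sepB
  obtain ⟨E1, k1, j1⟩ := h.hD _ h.ha₁
  obtain ⟨E2, k2, j2⟩ := h.hD _ h.ha₂
  obtain ⟨E3, k3, j3⟩ := h.hD _ h.hb₂
  subst e
  have s12 : Sep m a₁ b₂ := by
    have := (s'.symm.mr h E1).symm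
    rwa [j1] at this
  have R1 := h.rel (a := a₁) (b := b₂) (by tauto) (by tauto) s12
  have R2 := h.rel (a := a₂) (b := m a₁) (by tauto) (by tauto) (s.symm.mr h h.ha₁)
  rw [j1] at R2
  have qx' := h.hsym _ _ _ h.qx
  have qz' := h.hsym _ _ _ h.qz
  have qy' := h.hsym _ _ _ h.qy
  have o1 : b₃ ≠ a₁ := fun e => h.W e ⟨_, h.qx⟩ R2.2 h.ha₂ E2 k2.symm
  have o2 : b₃ ≠ m a₁ := fun e => h.W e ⟨_, h.qz⟩ R1.1 h.hb₂ E3 k3.symm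
  have R3 := h.rel (a := a₁) (b := b₃) (by tauto) (by tauto) (h.mkSep h.hb₃ h.ha₁ o1 o2).symm
  have K3 : b₃ = b₂ ∨ b₃ = m b₂ := by
    rcases h.L1 _ _ _ _ ⟨_, h.qz⟩ R1.1 R3.1 with h' | h' | h'
    · exact absurd h'.symm k3
    · right; rw [h', (h.hD _ h.hb₃).2.2]
    · left; exact (h.inj h.hb₂ h.hb₃ h').symm
  rcases e3 with e3 | e3
  · subst e3
    have e4 : a₄ = m a₂ := by
      rcases h.L2 _ _ _ _ _ _ h.hxy h.qx h.qy R2.2 with h' | h'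
      · exact absurd h' k2
      · exact h'.symm
    subst e4
    by_cases c1 : b₂ = a₂
    · subst c1
      rcases K3 with K3 | K3
      · exact h.K qx' qz' (K3 ▸ h.qw) h.hxz h.hxw h.hzw
      · exact h.W K3 ⟨_, qy'⟩ R1.2 h.ha₁ E1 k1.symm
    by_cases c2 : b₂ = m a₂
    · subst c2
      rw [j2] at *
      rcases K3 with K3 | K3
      · exact h.K qy' qz' (K3 ▸ h.qw) h.hyz h.hyw h.hzw
      · exact h.W K3 ⟨_, qx'⟩ R1.2 h.ha₁ E1 k1.symm
    have s2 := h.mkSep h.hb₂ h.ha₂ c1 c2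
    have R4 := h.rel (a := m a₂) (b := b₂) (by tauto) (by tauto) (s2.mr h h.ha₂).symm
    have R5 := h.rel (a := a₂) (b := b₂) (by tauto) (by tauto) s2.symm
    rw [j2] at R4
    rcases h.L1 _ _ _ _ R4.2 R5.2 R1.2 with h' | h' | h'
    · exact k2 h'.symm
    · exact s.2.2.1 h'.symm
    · exact s.2.2.2 h'.symm
  · subst e3
    have e4 : a₄ = m b₂ := by
      rcases h.L2 _ _ _ _ _ _ h.hyz h.qy h.qz R1.1 with h' | h'
      · exact h'.symm
      · exact absurd h' k3
    subst e4
    have R4 := h.rel (a := m a₁) (b := b₂) (by tauto) (by tauto) s'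
    rw [j1] at R4
    have K2 : b₂ = a₂ ∨ b₂ = m a₂ := by
      rcases h.L1 _ _ _ _ ⟨_, h.qx⟩ R2.2 R4.1 with h' | h' | h'
      · exact absurd h'.symm k2
      · right; rw [h', j3]
      · left; exact (h.inj h.ha₂ h.hb₂ h').symm
    rcases K2 with K2 | K2
    · subst K2
      rcases K3 with K3 | K3
      · exact h.K qx' qz' (K3 ▸ h.qw) h.hxz h.hxw h.hzw
      · exact h.W K3 ⟨_, qy'⟩ R2.1 E1 h.ha₁ k1
    · subst K2
      rw [j2] at *
      rcases K3 with K3 | K3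
      · exact h.W K3 ⟨_, qz'⟩ R2.1 E1 h.ha₁ k1
      · exact h.W K3 ⟨_, qx'⟩ ⟨_, qy'⟩ h.ha₁ E1 k1.symm

/-- Case `b₁ = m a₁`. -/
theorem claim3e (h : Cfg Q m D x y z w a₁ a₂ a₃ a₄ b₁ b₂ b₃ c) (e : b₁ = m a₁) : False := by
  have s := h.sepA
  have s34 := h.swapXY.sepA
  have n3 : ¬ (a₃ = a₁ ∨ a₃ = m a₁) := fun e3 => h.claim3d e e3
  have n4 : ¬ (a₄ = a₁ ∨ a₄ = m a₁) := fun e4 => h.swapXY.swapA.swapXY.claim3d e e4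
  obtain ⟨E1, k1, j1⟩ := h.hD _ h.ha₁
  obtain ⟨E2, k2, j2⟩ := h.hD _ h.ha₂
  subst e
  have R2 := h.rel (a := a₂) (b := m a₁) (by tauto) (by tauto) (s.symm.mr h h.ha₁)
  rw [j1] at R2
  have key : ∀ a, (a = a₃ ∨ a = a₄) → D a → ¬ (a = a₁ ∨ a = m a₁) → a = a₂ ∨ a = m a₂ := by
    intro a ha Da hn
    push Not at hn
    have R := h.rel (a := a) (b := m a₁) (by tauto) (by tauto)
      ((h.mkSep Da h.ha₁ hn.1 hn.2).mr h h.ha₁)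
    rw [j1] at R
    rcases h.L1 _ _ _ _ ⟨_, h.qx⟩ R2.2 R.2 with h' | h' | h'
    · exact absurd h'.symm k2
    · right; rw [h', (h.hD a Da).2.2]
    · left; exact (h.inj h.ha₂ Da h').symm
  rcases key a₃ (by tauto) h.ha₃ n3 with h3 | h3 <;>
  rcases key a₄ (by tauto) h.ha₄ n4 with h4 | h4
  · exact s34.1 (h3.trans h4.symm)
  · exact s34.2.2.1 (by rw [h3, h4])
  · exact s34.2.1 (by rw [h3, h4])
  · exact s34.1 (h3.trans h4.symm)

theorem claim3 (h : Cfg Q m D x y z w a₁ a₂ a₃ a₄ b₁ b₂ b₃ c) : Sep m a₁ b₁ :=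
  (h.mkSep h.hb₁ h.ha₁ h.claim3c h.claim3e).symm

/-- The final shape of the configuration. -/
theorem shape (h : Cfg Q m D x y z w a₁ a₂ a₃ a₄ b₁ b₂ b₃ c) :
    Sep m a₁ a₂ ∧ Sep m b₁ b₂ ∧ Sep m a₁ b₁ ∧ Sep m a₁ b₂ ∧ Sep m a₂ b₁ ∧ Sep m a₂ b₂ ∧
    (a₃ = a₁ ∧ a₄ = a₂ ∨ a₃ = a₂ ∧ a₄ = a₁) ∧ (b₃ = b₁ ∨ b₃ = b₂) := by
  have s11 := h.claim3
  have s12 := h.swapB.claim3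
  have s21 := h.swapA.claim3
  have s22 := h.swapA.swapB.claim3
  have s31 := h.swapXY.claim3
  have s41 := h.swapXY.swapA.claim3
  have sA := h.sepA
  have sB := h.sepB
  refine ⟨sA, sB, s11, s12, s21, s22, ?_, ?_⟩
  · have R1 := (h.rel (a := a₁) (b := b₁) (by tauto) (by tauto) s11).2
    have R2 := (h.rel (a := a₂) (b := b₁) (by tauto) (by tauto) s21).2
    have R3 := (h.rel (a := a₃) (b := b₁) (by tauto) (by tauto) s31).2
    have R4 := (h.rel (a := a₄) (b := b₁) (by tauto) (by tauto) s41).2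
    have K3 : a₃ = a₁ ∨ a₃ = a₂ := by
      rcases h.L1 _ _ _ _ R1 R2 R3 with h' | h' | h'
      · exact absurd h' sA.2.2.2
      · exact Or.inl (h.inj h.ha₁ h.ha₃ h').symm
      · exact Or.inr (h.inj h.ha₂ h.ha₃ h').symm
    have K4 : a₄ = a₁ ∨ a₄ = a₂ := by
      rcases h.L1 _ _ _ _ R1 R2 R4 with h' | h' | h'
      · exact absurd h' sA.2.2.2
      · exact Or.inl (h.inj h.ha₁ h.ha₄ h').symm
      · exact Or.inr (h.inj h.ha₂ h.ha₄ h').symm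
    have := h.hne _ _ _ h.qy
    grind
  · by_contra hn
    push Not at hn
    have key : ∀ a, (a = a₁ ∨ a = a₂) → Sep m a b₁ → Sep m a b₂ → Sep m a b₃ → False := by
      intro a ha t1 t2 t3
      have R1 := (h.rel (a := a) (b := b₁) (by tauto) (by tauto) t1).1
      have R2 := (h.rel (a := a) (b := b₂) (by tauto) (by tauto) t2).1
      have R3 := (h.rel (a := a) (b := b₃) (by tauto) (by tauto) t3).1
      rcases h.L1 _ _ _ _ R1 R2 R3 with h' | h' | h'
      · exact sB.2.2.2 h'
      · exact hn.1 (h.inj h.hb₁ h.hb₃ h').symm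
      · exact hn.2 (h.inj h.hb₂ h.hb₃ h').symm
    have n1 : ¬ Sep m a₁ b₃ := key a₁ (by tauto) s11 s12
    have n2 : ¬ Sep m a₂ b₃ := key a₂ (by tauto) s21 s22
    have f1 : a₁ = b₃ ∨ a₁ = m b₃ := by
      by_contra hh
      push Not at hh
      exact n1 (h.mkSep h.ha₁ h.hb₃ hh.1 hh.2)
    have f2 : a₂ = b₃ ∨ a₂ = m b₃ := by
      by_contra hh
      push Not at hh
      exact n2 (h.mkSep h.ha₂ h.hb₃ hh.1 hh.2)
    have i3 := (h.hD _ h.hb₃).2.2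
    rcases f1 with f1 | f1 <;> rcases f2 with f2 | f2
    · exact sA.1 (f1.trans f2.symm)
    · exact sA.2.2.1 (by rw [f1, f2])
    · exact sA.2.1 (by rw [f1, f2])
    · exact sA.1 (f1.trans f2.symm)

end Cfg

set_option linter.unusedSectionVars false

section graphPart

variable {V : Type*} [Fintype V] [DecidableEq V] {G : SimpleGraph V} {S : Finset V} {m : V → V}

/-- Adding a new edge to a matched set. -/
theorem addPair {T : Finset V} (hT : ∃ m : V → V, IsMatchingOn G T m) {p q : V}
    (hp : p ∉ T) (hq : q ∉ T) (hpq : G.Adj p q) :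
    ∃ m : V → V, IsMatchingOn G (insert p (insert q T)) m := by
  obtain ⟨m, hm⟩ := hT
  have hne := hpq.ne
  refine ⟨fun v => if v = p then q else if v = q then p else m v, ?_⟩
  intro v hv
  rw [Finset.mem_insert, Finset.mem_insert] at hv
  by_cases h1 : v = p
  · subst h1
    simp [hne.symm, hpq]
  by_cases h2 : v = q
  · subst h2
    simp [hne, hne.symm, hpq.symm]
  have hv' : v ∈ T := by tauto
  obtain ⟨k1, k2, k3, k4⟩ := hm v hv'
  have h3 : m v ≠ p := fun e => hp (e ▸ k1)
  have h4 : m v ≠ q := fun e => hq (e ▸ k1)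
  simp [h1, h2, h3, h4, k1, k2, k3, k4]

/-- Removing a pair from a matched set. -/
theorem removePair (hm : IsMatchingOn G S m) {T : Finset V}
    (hT : ∀ v ∈ T, v ∈ S ∧ m v ∈ T) : IsMatchingOn G T m := by
  intro v hv
  obtain ⟨k1, k2, k3, k4⟩ := hm v (hT v hv).1
  exact ⟨(hT v hv).2, k2, k3, k4⟩

/-- In a cubic graph, three distinct neighbours are all neighbours. -/
theorem nbr_cases [DecidableRel G.Adj] (hcubic : ∀ v : V, G.degree v = 3) {v p q r t : V}
    (hp : G.Adj v p) (hq : G.Adj v q) (hr : G.Adj v r) (ht : G.Adj v t)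
    (h1 : p ≠ q) (h2 : p ≠ r) (h3 : q ≠ r) : t = p ∨ t = q ∨ t = r := by
  have hsub : ({p, q, r} : Finset V) ⊆ G.neighborFinset v := by
    intro s hs
    simp only [Finset.mem_insert, Finset.mem_singleton] at hs
    rw [SimpleGraph.mem_neighborFinset]
    rcases hs with rfl | rfl | rfl <;> assumption
  have hcard : ({p, q, r} : Finset V).card = 3 := Finset.card_eq_three.2 ⟨p, q, r, h1, h2, h3, rfl⟩
  have heq := Finset.eq_of_subset_of_card_le hsub (by
    rw [hcard, SimpleGraph.card_neighborFinset_eq_degree, hcubic])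
  have : t ∈ G.neighborFinset v := (SimpleGraph.mem_neighborFinset _ _ _).2 ht
  rw [← heq] at this
  simpa using this

/-- The trace relation. -/
def Tr (G : SimpleGraph V) (S : Finset V) (u ub p v t : V) : Prop :=
  p ∉ S ∧ v ∈ S ∧ t ∈ S ∧ v ≠ t ∧ v ≠ u ∧ v ≠ ub ∧ t ≠ u ∧ t ≠ ub ∧ G.Adj p v ∧ G.Adj p t ∧
    ∀ s ∈ S, G.Adj p s → s = u ∨ s = ub ∨ s = v ∨ s = t

set_option maxHeartbeats 2000000 in
/-- The constraint lemma. -/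
theorem constraint (hdom : ∀ v : V, v ∉ S → ∃ u ∈ S, G.Adj v u)
    (hmatch : IsMatchingOn G S m)
    (hmincard : ∀ T : Finset V, IsPDS G T → S.card ≤ T.card)
    {D : V → Prop} (hDS : ∀ v, D v → v ∈ S) (hDm : ∀ v, D v → D (m v))
    (hDp : ∀ v p, D v → p ∉ S → G.Adj p v → ∃ s ∈ S, s ≠ v ∧ G.Adj p s)
    {u ub : V} (hub : m u = ub) (hu : D u)
    (hN : ∀ q, q ∉ S → (G.Adj q u ∨ G.Adj q ub) →
      ∃ v t, v ∈ S ∧ t ∈ S ∧ v ≠ t ∧ v ≠ u ∧ v ≠ ub ∧ t ≠ u ∧ t ≠ ub ∧ G.Adj q v ∧ G.Adj q t)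
    {q₁ q₂ a b : V} (h1 : q₁ ∉ S) (h2 : q₂ ∉ S) (h1u : G.Adj q₁ u) (h2u : G.Adj q₂ ub)
    (h1a : G.Adj q₁ a) (h2b : G.Adj q₂ b) (h12 : q₁ ≠ q₂)
    (ha : D a) (hb : D b) (hau : a ≠ u) (haub : a ≠ ub) (hbu : b ≠ u) (hbub : b ≠ ub)
    (hab : a ≠ b) (hab' : m a ≠ b) : ∃ p, Tr G S u ub p (m a) (m b) := by
  obtain ⟨au1, au2, au3, au4⟩ := hmatch u (hDS u hu)
  obtain ⟨aa1, aa2, aa3, aa4⟩ := hmatch a (hDS a ha)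
  obtain ⟨ab1, ab2, ab3, ab4⟩ := hmatch b (hDS b hb)
  have au0 := hDS u hu
  have aa0 := hDS a ha
  have ab0 := hDS b hb
  subst hub
  have d1 : m a ≠ m b := fun e => hab (by rw [← aa4, e, ab4])
  have d2 : m a ≠ u := fun e => haub (by rw [← aa4, e])
  have d3 : m b ≠ u := fun e => hbub (by rw [← ab4, e])
  have d4 : m a ≠ m u := fun e => hau (by rw [← aa4, e, au4])
  have d5 : m b ≠ m u := fun e => hbu (by rw [← ab4, e, au4])
  have d6 : a ≠ m b := fun e => hab' (by rw [e, ab4])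
  by_contra hno
  push Not at hno
  obtain ⟨R, hRdef⟩ : ∃ R : Finset V, R = {u, m u, a, m a, b, m b} := ⟨_, rfl⟩
  have hR : ∀ s, s ∈ R ↔ s = u ∨ s = m u ∨ s = a ∨ s = m a ∨ s = b ∨ s = m b := by
    intro s; simp [hRdef]
  have hRcard : R.card = 6 := by
    rw [hRdef]
    repeat rw [Finset.card_insert_of_notMem]
    all_goals simp
    all_goals grind
  have hRS : R ⊆ S := by
    intro s hs
    rcases (hR s).1 hs with rfl | rfl | rfl | rfl | rfl | rfl <;> assumption
  have hT0 : ∃ m : V → V, IsMatchingOn G (S \ R) m := by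
    refine ⟨m, removePair hmatch ?_⟩
    intro v hv
    rw [Finset.mem_sdiff, hR] at hv
    obtain ⟨k1, k2, k3, k4⟩ := hmatch v hv.1
    refine ⟨hv.1, ?_⟩
    rw [Finset.mem_sdiff, hR]
    refine ⟨k1, ?_⟩
    grind
  have hT1 : ∃ m : V → V, IsMatchingOn G (insert a (insert q₁ (S \ R))) m :=
    addPair hT0 (by simp [hR]) (by simp [h1]) h1a.symm
  have hT2 : ∃ m : V → V, IsMatchingOn G (insert b (insert q₂ (insert a (insert q₁ (S \ R))))) m :=
    addPair hT1 (by simp [hR]; grind) (by simp [h2]; grind) h2b.symm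
  have hle := hmincard _ (show IsPDS G _ from ⟨?_, hT2⟩)
  · have c1 := Finset.card_sdiff_add_card_eq_card hRS
    have c2 := Finset.card_insert_le b (insert q₂ (insert a (insert q₁ (S \ R))))
    have c3 := Finset.card_insert_le q₂ (insert a (insert q₁ (S \ R)))
    have c4 := Finset.card_insert_le a (insert q₁ (S \ R))
    have c5 := Finset.card_insert_le q₁ (S \ R)
    omega
  intro q hq
  have hmem : ∀ s, s ∈ (insert b (insert q₂ (insert a (insert q₁ (S \ R))))) ↔
      s = b ∨ s = q₂ ∨ s = a ∨ s = q₁ ∨ (s ∈ S ∧ s ∉ R) := by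
    intro s; simp only [Finset.mem_insert, Finset.mem_sdiff]
  by_cases hqS : q ∈ S
  · have hqR : q = u ∨ q = m u ∨ q = m a ∨ q = m b := by
      rw [hmem, hR] at hq; tauto
    rcases hqR with rfl | rfl | rfl | rfl
    · exact ⟨q₁, by rw [hmem]; tauto, h1u.symm⟩
    · exact ⟨q₂, by rw [hmem]; tauto, h2u.symm⟩
    · exact ⟨a, by rw [hmem]; tauto, aa3.symm⟩
    · exact ⟨b, by rw [hmem]; tauto, ab3.symm⟩
  by_contra hcon
  push Not at hcon
  have hall : ∀ s ∈ S, G.Adj q s → s = u ∨ s = m u ∨ s = m a ∨ s = m b := by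
    intro s hs hadj
    by_contra hn
    refine hcon s ?_ hadj
    rw [hmem, hR]
    tauto
  have hnot : ¬ (G.Adj q (m a) ∧ G.Adj q (m b)) := by
    rintro ⟨k1, k2⟩
    exact hno q ⟨hqS, aa1, ab1, d1, d2, d4, d3, d5, k1, k2, hall⟩
  have hnu : ¬ (G.Adj q u ∨ G.Adj q (m u)) := by
    intro hh
    obtain ⟨v, t, k1, k2, k3, k4, k5, k6, k7, k8, k9⟩ := hN q hqS hh
    have e1 := hall v k1 k8
    have e2 := hall t k2 k9
    grind
  obtain ⟨s, hs, hadj⟩ := hdom q hqS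
  have e1 := hall s hs hadj
  have e2 : D s := by
    rcases e1 with rfl | rfl | rfl | rfl
    exacts [hu, hDm _ hu, hDm _ ha, hDm _ hb]
  obtain ⟨s', hs', hne, hadj'⟩ := hDp s q e2 hqS hadj
  have e3 := hall s' hs' hadj'
  grind

set_option maxHeartbeats 2000000 in
/-- The final replacement: five pairs are replaced by four pairs. -/
theorem final_swap (hmatch : IsMatchingOn G S m)
    (hmincard : ∀ T : Finset V, IsPDS G T → S.card ≤ T.card)
    (hdom : ∀ v : V, v ∉ S → ∃ u ∈ S, G.Adj v u)
    {u a₁ a₂ b₁ b₂ x z p₁ p₂ : V}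
    (hu : u ∈ S) (ha₁ : a₁ ∈ S) (ha₂ : a₂ ∈ S) (hb₁ : b₁ ∈ S) (hb₂ : b₂ ∈ S)
    (sa : Cfg.Sep m u a₁) (sa' : Cfg.Sep m u a₂) (sb : Cfg.Sep m u b₁) (sb' : Cfg.Sep m u b₂)
    (s1 : Cfg.Sep m a₁ a₂) (s2 : Cfg.Sep m b₁ b₂) (s3 : Cfg.Sep m a₁ b₁) (s4 : Cfg.Sep m a₁ b₂)
    (s5 : Cfg.Sep m a₂ b₁) (s6 : Cfg.Sep m a₂ b₂)
    (hx : x ∉ S) (hz : z ∉ S) (hp₁ : p₁ ∉ S) (hp₂ : p₂ ∉ S)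
    (hxz : x ≠ z) (hxp : x ≠ p₁) (hxp' : x ≠ p₂) (hzp : z ≠ p₁) (hzp' : z ≠ p₂) (hpp : p₁ ≠ p₂)
    (xu : G.Adj x u) (xa₁ : G.Adj x a₁) (xa₂ : G.Adj x a₂)
    (zu : G.Adj z (m u)) (zb₁ : G.Adj z b₁) (zb₂ : G.Adj z b₂)
    (pa₁ : G.Adj p₁ (m a₁)) (pa₂ : G.Adj p₂ (m a₂)) (pb₂ : G.Adj p₂ (m b₂))
    (hqu : ∀ q, q ∉ S → G.Adj q u → G.Adj q a₁)
    (hqub : ∀ q, q ∉ S → G.Adj q (m u) → G.Adj q b₁)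
    (hqa : ∀ q, q ∉ S → G.Adj q a₂ → G.Adj q a₁)
    (hqb : ∀ q, q ∉ S → G.Adj q (m b₁) → G.Adj q (m a₁) ∨ G.Adj q (m a₂))
    (hqb' : ∀ q, q ∉ S → G.Adj q (m b₂) → G.Adj q (m a₁) ∨ G.Adj q (m a₂))
    (hpriv : ∀ q, q ∉ S → G.Adj q b₂ → ∃ s ∈ S, s ≠ b₂ ∧ G.Adj q s) : False := by
  obtain ⟨u1, u2, u3, u4⟩ := hmatch u hu
  obtain ⟨c1, c2, c3, c4⟩ := hmatch a₁ ha₁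
  obtain ⟨d1, d2, d3, d4⟩ := hmatch a₂ ha₂
  obtain ⟨e1, e2, e3, e4⟩ := hmatch b₁ hb₁
  obtain ⟨f1, f2, f3, f4⟩ := hmatch b₂ hb₂
  obtain ⟨R, hRdef⟩ : ∃ R : Finset V,
      R = {u, m u, a₁, m a₁, a₂, m a₂, b₁, m b₁, b₂, m b₂} := ⟨_, rfl⟩
  have hR : ∀ s, s ∈ R ↔ s = u ∨ s = m u ∨ s = a₁ ∨ s = m a₁ ∨ s = a₂ ∨ s = m a₂ ∨
      s = b₁ ∨ s = m b₁ ∨ s = b₂ ∨ s = m b₂ := by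
    intro s; simp [hRdef]
  unfold Cfg.Sep at *
  have hRcard : R.card = 10 := by
    rw [hRdef]
    repeat rw [Finset.card_insert_of_notMem]
    all_goals simp only [Finset.mem_insert, Finset.mem_singleton, Finset.card_singleton, not_or]
    all_goals
      refine_lift ?_
      tauto
  have hRS : R ⊆ S := by
    intro s hs
    rcases (hR s).1 hs with h | h | h | h | h | h | h | h | h | h <;> rw [h] <;> assumption
  have hT0 : ∃ m : V → V, IsMatchingOn G (S \ R) m := by
    refine ⟨m, removePair hmatch ?_⟩
    intro v hv
    rw [Finset.mem_sdiff, hR] at hv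
    obtain ⟨k1, k2, k3, k4⟩ := hmatch v hv.1
    refine ⟨hv.1, ?_⟩
    rw [Finset.mem_sdiff, hR]
    refine ⟨k1, ?_⟩
    intro hh
    apply hv.2
    rw [← k4]
    rcases hh with h | h | h | h | h | h | h | h | h | h <;> rw [h] <;> simp [*]
  have hT1 := addPair hT0 (p := a₁) (q := x) (by simp [hR]) (by simp [hx]) xa₁.symm
  have hT2 := addPair hT1 (p := b₁) (q := z)
    (by simp only [Finset.mem_insert, Finset.mem_sdiff, hR]; grind)
    (by simp only [Finset.mem_insert, Finset.mem_sdiff, hR]; grind) zb₁.symm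
  have hT3 := addPair hT2 (p := m a₂) (q := p₂)
    (by simp only [Finset.mem_insert, Finset.mem_sdiff, hR]; grind)
    (by simp only [Finset.mem_insert, Finset.mem_sdiff, hR]; grind) pa₂.symm
  have hT4 := addPair hT3 (p := m a₁) (q := p₁)
    (by simp only [Finset.mem_insert, Finset.mem_sdiff, hR]; grind)
    (by simp only [Finset.mem_insert, Finset.mem_sdiff, hR]; grind) pa₁.symm
  obtain ⟨T, hT⟩ : ∃ T, T = insert (m a₁) (insert p₁ (insert (m a₂) (insert p₂
    (insert b₁ (insert z (insert a₁ (insert x (S \ R)))))))) := ⟨_, rfl⟩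
  rw [← hT] at hT4
  have hTcard : T.card ≤ (S \ R).card + 8 := by
    rw [hT]
    iterate 8 refine (Finset.card_insert_le _ _).trans (Nat.succ_le_succ ?_)
    exact le_rfl
  have hmem : ∀ s, s ∈ T ↔ s = m a₁ ∨ s = p₁ ∨ s = m a₂ ∨ s = p₂ ∨ s = b₁ ∨ s = z ∨ s = a₁ ∨
      s = x ∨ (s ∈ S ∧ s ∉ R) := by
    intro s; rw [hT]; simp only [Finset.mem_insert, Finset.mem_sdiff]
  have ta₁ : a₁ ∈ T := (hmem _).2 (by tauto)
  have ta₁' : m a₁ ∈ T := (hmem _).2 (by tauto)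
  have ta₂' : m a₂ ∈ T := (hmem _).2 (by tauto)
  have tb₁ : b₁ ∈ T := (hmem _).2 (by tauto)
  have tx : x ∈ T := (hmem _).2 (by tauto)
  have tz : z ∈ T := (hmem _).2 (by tauto)
  have tp₂ : p₂ ∈ T := (hmem _).2 (by tauto)
  have hle := hmincard T ⟨?_, hT4⟩
  · have c1 := Finset.card_sdiff_add_card_eq_card hRS
    omega
  intro q hq
  by_contra hcon
  push Not at hcon
  have hkept : ∀ s, s ∈ S → G.Adj q s → s ∈ R ∧ s ≠ a₁ ∧ s ≠ b₁ ∧ s ≠ m a₁ ∧ s ≠ m a₂ := by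
    intro s hs hadj
    have hsT : s ∉ T := fun h => hcon s h hadj
    rw [hmem] at hsT
    tauto
  by_cases hqS : q ∈ S
  · have hqR : q ∈ R := by
      by_contra hn
      exact hq ((hmem q).2 (by tauto))
    rcases (hR q).1 hqR with h | h | h | h | h | h | h | h | h | h <;> subst h
    · exact hcon x tx xu.symm
    · exact hcon z tz zu.symm
    · exact hq ta₁
    · exact hq ta₁'
    · exact hcon x tx xa₂.symm
    · exact hq ta₂'
    · exact hq tb₁
    · exact hcon b₁ tb₁ e3.symm
    · exact hcon z tz zb₂.symm
    · exact hcon p₂ tp₂ pb₂.symm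
  have n1 : ¬ G.Adj q u := fun h => hcon a₁ ta₁ (hqu q hqS h)
  have n2 : ¬ G.Adj q (m u) := fun h => hcon b₁ tb₁ (hqub q hqS h)
  have n3 : ¬ G.Adj q a₂ := fun h => hcon a₁ ta₁ (hqa q hqS h)
  have n4 : ¬ G.Adj q (m b₁) := fun h => (hqb q hqS h).elim (hcon _ ta₁') (hcon _ ta₂')
  have n5 : ¬ G.Adj q (m b₂) := fun h => (hqb' q hqS h).elim (hcon _ ta₁') (hcon _ ta₂')
  have only : ∀ s ∈ S, G.Adj q s → s = b₂ := by
    intro s hs hadj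
    obtain ⟨k1, k2, k3, k4, k5⟩ := hkept s hs hadj
    rcases (hR s).1 k1 with h | h | h | h | h | h | h | h | h | h
    · exact absurd (h ▸ hadj) n1
    · exact absurd (h ▸ hadj) n2
    · exact absurd h k2
    · exact absurd h k4
    · exact absurd (h ▸ hadj) n3
    · exact absurd h k5
    · exact absurd h k3
    · exact absurd (h ▸ hadj) n4
    · exact h
    · exact absurd (h ▸ hadj) n5
  obtain ⟨s, hs, hadj⟩ := hdom q hqS
  have e := only s hs hadj
  subst e
  obtain ⟨s', hs', hne, hadj'⟩ := hpriv q hqS hadj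
  exact hne (only s' hs' hadj')


set_option maxHeartbeats 1000000 in
/-- The configuration with `b₃ = b₁` is impossible. -/
theorem core_aux [DecidableRel G.Adj] (hcubic : ∀ v : V, G.degree v = 3)
    (hmatch : IsMatchingOn G S m)
    (hmincard : ∀ T : Finset V, IsPDS G T → S.card ≤ T.card)
    (hdom : ∀ v : V, v ∉ S → ∃ u ∈ S, G.Adj v u)
    {D : V → Prop} (hDS : ∀ v, D v → v ∈ S)
    (hDp : ∀ v p, D v → p ∉ S → G.Adj p v → ∃ s ∈ S, s ≠ v ∧ G.Adj p s)
    {u x y z w a₁ a₂ a₃ a₄ b₁ b₂ b₃ c : V} (hu : D u)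
    (h : Cfg (Tr G S u (m u)) m D x y z w a₁ a₂ a₃ a₄ b₁ b₂ b₃ c)
    (xu : G.Adj x u) (yu : G.Adj y u) (zu : G.Adj z (m u)) (wu : G.Adj w (m u))
    (hb : b₃ = b₁) : False := by
  obtain ⟨sA, sB, s11, s12, s21, s22, h34, -⟩ := h.shape
  obtain ⟨⟨p₁, hp₁⟩, -⟩ := h.rel (a := a₁) (b := b₁) (by tauto) (by tauto) s11
  obtain ⟨⟨p₂, hp₂⟩, -⟩ := h.rel (a := a₂) (b := b₂) (by tauto) (by tauto) s22
  obtain ⟨⟨p₃, hp₃⟩, -⟩ := h.rel (a := a₁) (b := b₂) (by tauto) (by tauto) s12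
  obtain ⟨⟨p₄, hp₄⟩, -⟩ := h.rel (a := a₂) (b := b₁) (by tauto) (by tauto) s21
  have hy : Tr G S u (m u) y a₁ a₂ := by
    rcases h34 with ⟨e1, e2⟩ | ⟨e1, e2⟩
    · rw [← e1, ← e2]; exact h.qy
    · rw [← e1, ← e2]; exact h.hsym _ _ _ h.qy
  have hw : Tr G S u (m u) w b₁ c := hb ▸ h.qw
  have hx := h.qx
  have hz := h.qz
  obtain ⟨x0, x1, x2, x3, x4, x5, x6, x7, x8, x9, x10⟩ := hx
  obtain ⟨y0, -, -, -, -, -, -, -, y8, y9, y10⟩ := hy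
  obtain ⟨z0, z1, z2, z3, z4, z5, z6, z7, z8, z9, z10⟩ := hz
  obtain ⟨w0, -, -, -, -, -, -, -, w8, w9, w10⟩ := hw
  obtain ⟨f0, f1, f2, f3, f4, f5, f6, f7, f8, f9, f10⟩ := hp₁
  obtain ⟨g0, g1, g2, g3, g4, g5, g6, g7, g8, g9, g10⟩ := hp₂
  obtain ⟨k0, -, -, -, -, -, -, -, k8, k9, k10⟩ := hp₃
  obtain ⟨l0, -, -, -, -, -, -, -, l8, l9, l10⟩ := hp₄
  obtain ⟨u1, u2, u3, u4⟩ := hmatch u (hDS u hu)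
  obtain ⟨ma1, ma2, ma3, ma4⟩ := hmatch a₁ x1
  obtain ⟨na1, na2, na3, na4⟩ := hmatch a₂ x2
  obtain ⟨mb1, mb2, mb3, mb4⟩ := hmatch b₁ z1
  obtain ⟨nb1, nb2, nb3, nb4⟩ := hmatch b₂ z2
  have nS : ∀ {p s : V}, p ∉ S → s ∈ S → p ≠ s := fun hp hs e => hp (e ▸ hs)
  have p14 : p₁ ≠ p₄ := by
    rintro rfl
    rcases l10 _ f1 f8 with e | e | e | e
    exacts [f4 e, f5 e, sA.2.2.2 e, s11.2.2.2 e]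
  have p32 : p₃ ≠ p₂ := by
    rintro rfl
    rcases g10 _ ma1 k8 with e | e | e | e
    exacts [f4 e, f5 e, sA.2.2.2 e, s12.2.2.2 e]
  refine final_swap (x := x) (z := z) (p₁ := p₁) (p₂ := p₂) hmatch hmincard hdom (hDS u hu)
    x1 x2 z1 z2
    (h.mkSep hu h.ha₁ x4.symm f4.symm) (h.mkSep hu h.ha₂ x6.symm g4.symm)
    (h.mkSep hu h.hb₁ z4.symm f6.symm) (h.mkSep hu h.hb₂ z6.symm g6.symm)
    sA sB s11 s12 s21 s22 x0 z0 f0 g0 h.hxz ?_ ?_ ?_ ?_ ?_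
    xu x8 x9 zu z8 z9 f8 g8 g9 ?_ ?_ ?_ ?_ ?_ ?_
  · rintro rfl
    rcases x10 _ f1 f8 with e | e | e | e
    exacts [f4 e, f5 e, ma2 e, sA.2.2.1 e]
  · rintro rfl
    rcases x10 _ g1 g8 with e | e | e | e
    exacts [g4 e, g5 e, sA.2.1 e.symm, na2 e]
  · rintro rfl
    rcases z10 _ f1 f8 with e | e | e | e
    exacts [f4 e, f5 e, s11.2.2.1 e, s12.2.2.1 e]
  · rintro rfl
    rcases z10 _ g1 g8 with e | e | e | e
    exacts [g4 e, g5 e, s21.2.2.1 e, s22.2.2.1 e]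
  · rintro rfl
    rcases g10 _ f1 f8 with e | e | e | e
    exacts [f4 e, f5 e, sA.2.2.2 e, s12.2.2.2 e]
  · intro q hq hadj
    rcases nbr_cases hcubic u3 xu.symm yu.symm hadj.symm (nS x0 u1).symm (nS y0 u1).symm h.hxy
      with e | e | e
    · exact absurd u1 (e ▸ hq)
    · exact e ▸ x8
    · exact e ▸ y8
  · intro q hq hadj
    rcases nbr_cases hcubic u3.symm zu.symm wu.symm hadj.symm (nS z0 (hDS u hu)).symm
      (nS w0 (hDS u hu)).symm h.hzw with e | e | e
    · exact absurd (hDS u hu) (e ▸ hq)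
    · exact e ▸ z8
    · exact e ▸ w8
  · intro q hq hadj
    rcases nbr_cases hcubic na3 x9.symm y9.symm hadj.symm (nS x0 na1).symm (nS y0 na1).symm h.hxy
      with e | e | e
    · exact absurd na1 (e ▸ hq)
    · exact e ▸ x8
    · exact e ▸ y8
  · intro q hq hadj
    rcases nbr_cases hcubic mb3.symm f9.symm l9.symm hadj.symm (nS f0 z1).symm (nS l0 z1).symm p14
      with e | e | e
    · exact absurd z1 (e ▸ hq)
    · exact Or.inl (e ▸ f8)
    · exact Or.inr (e ▸ l8)
  · intro q hq hadj
    rcases nbr_cases hcubic nb3.symm k9.symm g9.symm hadj.symm (nS k0 z2).symm (nS g0 z2).symm p32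
      with e | e | e
    · exact absurd z2 (e ▸ hq)
    · exact Or.inl (e ▸ k8)
    · exact Or.inr (e ▸ g8)
  · intro q hq hadj
    exact hDp b₂ q h.hb₂ hq hadj

set_option maxHeartbeats 1000000 in
/-- The core statement. -/
theorem core [DecidableRel G.Adj] (hcubic : ∀ v : V, G.degree v = 3)
    (hdom : ∀ v : V, v ∉ S → ∃ u ∈ S, G.Adj v u)
    (hmatch : IsMatchingOn G S m)
    (hmincard : ∀ T : Finset V, IsPDS G T → S.card ≤ T.card)
    {D : V → Prop} (hDS : ∀ v, D v → v ∈ S) (hDm : ∀ v, D v → D (m v))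
    (hDp : ∀ v p, D v → p ∉ S → G.Adj p v → ∃ s ∈ S, s ≠ v ∧ G.Adj p s)
    {u x y z w : V} (hu : D u)
    (hcom : ¬ ∃ x : V, x ∉ S ∧ G.Adj u x ∧ G.Adj (m u) x)
    (x0 : x ∉ S) (y0 : y ∉ S) (z0 : z ∉ S) (w0 : w ∉ S) (hxy : x ≠ y) (hzw : z ≠ w)
    (xu : G.Adj x u) (yu : G.Adj y u) (zu : G.Adj z (m u)) (wu : G.Adj w (m u))
    (tx : ∃ a b, D a ∧ D b ∧ u ≠ a ∧ u ≠ b ∧ a ≠ b ∧ nbrS G S x = {u, a, b})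
    (ty : ∃ a b, D a ∧ D b ∧ u ≠ a ∧ u ≠ b ∧ a ≠ b ∧ nbrS G S y = {u, a, b})
    (tz : ∃ a b, D a ∧ D b ∧ m u ≠ a ∧ m u ≠ b ∧ a ≠ b ∧ nbrS G S z = {m u, a, b})
    (tw : ∃ a b, D a ∧ ¬ D b ∧ m u ≠ a ∧ m u ≠ b ∧ a ≠ b ∧ nbrS G S w = {m u, a, b}) :
    False := by
  have conv : ∀ {p v a b : V}, nbrS G S p = {v, a, b} →
      ∀ s, (s ∈ S ∧ G.Adj p s) ↔ (s = v ∨ s = a ∨ s = b) := by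
    intro p v a b e s
    have : s ∈ nbrS G S p ↔ s ∈ ({v, a, b} : Finset V) := by rw [e]
    simpa [nbrS] using this
  have hcom' : ∀ q, q ∉ S → G.Adj q u → G.Adj q (m u) → False :=
    fun q h1 h2 h3 => hcom ⟨q, h1, h2.symm, h3.symm⟩
  have mkTr : ∀ {p a b : V}, p ∉ S → G.Adj p u → u ≠ a → u ≠ b → a ≠ b →
      nbrS G S p = {u, a, b} → Tr G S u (m u) p a b := by
    intro p a b h0 h1 h2 h3 h4 e
    have c := conv e
    have ca := (c a).2 (by tauto)
    have cb := (c b).2 (by tauto)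
    refine ⟨h0, ca.1, cb.1, h4, h2.symm, fun e => ?_, h3.symm, fun e => ?_, ca.2, cb.2, ?_⟩
    · exact hcom' p h0 h1 (e ▸ ca.2)
    · exact hcom' p h0 h1 (e ▸ cb.2)
    · intro s hs hadj
      have := (c s).1 ⟨hs, hadj⟩
      tauto
  have mkTr' : ∀ {p a b : V}, p ∉ S → G.Adj p (m u) → m u ≠ a → m u ≠ b → a ≠ b →
      nbrS G S p = {m u, a, b} → Tr G S u (m u) p a b := by
    intro p a b h0 h1 h2 h3 h4 e
    have c := conv e
    have ca := (c a).2 (by tauto)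
    have cb := (c b).2 (by tauto)
    refine ⟨h0, ca.1, cb.1, h4, fun e => ?_, h2.symm, fun e => ?_, h3.symm, ca.2, cb.2, ?_⟩
    · exact hcom' p h0 (e ▸ ca.2) h1
    · exact hcom' p h0 (e ▸ cb.2) h1
    · intro s hs hadj
      have := (c s).1 ⟨hs, hadj⟩
      tauto
  obtain ⟨a₁, a₂, ha₁, ha₂, x1, x2, x3, ex⟩ := tx
  obtain ⟨a₃, a₄, ha₃, ha₄, y1, y2, y3, ey⟩ := ty
  obtain ⟨b₁, b₂, hb₁, hb₂, z1, z2, z3, ez⟩ := tz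
  obtain ⟨b₃, c, hb₃, hc, w1, w2, w3, ew⟩ := tw
  have qx := mkTr x0 xu x1 x2 x3 ex
  have qy := mkTr y0 yu y1 y2 y3 ey
  have qz := mkTr' z0 zu z1 z2 z3 ez
  have qw := mkTr' w0 wu w1 w2 w3 ew
  have ne : ∀ p q, p ∉ S → G.Adj p u → G.Adj q (m u) → p ≠ q := by
    rintro p q h0 h1 h2 rfl
    exact hcom' p h0 h1 h2
  have u1 := (hmatch u (hDS u hu)).1
  have u3 := (hmatch u (hDS u hu)).2.2.1
  have nS : ∀ {p s : V}, p ∉ S → s ∈ S → p ≠ s := fun hp hs e => hp (e ▸ hs)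
  have fromTr : ∀ {p a b : V}, Tr G S u (m u) p a b → ∃ v t, v ∈ S ∧ t ∈ S ∧ v ≠ t ∧ v ≠ u ∧
      v ≠ m u ∧ t ≠ u ∧ t ≠ m u ∧ G.Adj p v ∧ G.Adj p t := by
    rintro p a b ⟨h0, h1, h2, h3, h4, h5, h6, h7, h8, h9, -⟩
    exact ⟨a, b, h1, h2, h3, h4, h5, h6, h7, h8, h9⟩
  have hN : ∀ q, q ∉ S → (G.Adj q u ∨ G.Adj q (m u)) →
      ∃ v t, v ∈ S ∧ t ∈ S ∧ v ≠ t ∧ v ≠ u ∧ v ≠ m u ∧ t ≠ u ∧ t ≠ m u ∧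
        G.Adj q v ∧ G.Adj q t := by
    intro q hq hadj
    rcases hadj with hadj | hadj
    · rcases nbr_cases hcubic u3 xu.symm yu.symm hadj.symm (nS x0 u1).symm (nS y0 u1).symm hxy
        with e | e | e
      · exact absurd u1 (e ▸ hq)
      · exact e ▸ fromTr qx
      · exact e ▸ fromTr qy
    · rcases nbr_cases hcubic u3.symm zu.symm wu.symm hadj.symm (nS z0 (hDS u hu)).symm
        (nS w0 (hDS u hu)).symm hzw with e | e | e
      · exact absurd (hDS u hu) (e ▸ hq)
      · exact e ▸ fromTr qz
      · exact e ▸ fromTr qw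
  have h : Cfg (Tr G S u (m u)) m D x y z w a₁ a₂ a₃ a₄ b₁ b₂ b₃ c := by
    refine ⟨?_, ?_, ?_, ?_, ?_, hxy, ne x z x0 xu zu, ne x w x0 xu wu, ne y z y0 yu zu,
      ne y w y0 yu wu, hzw, qx, qy, qz, qw, ha₁, ha₂, ha₃, ha₄, hb₁, hb₂, hb₃, hc, ?_⟩
    · rintro p v t ⟨h0, h1, h2, h3, h4, h5, h6, h7, h8, h9, h10⟩
      refine ⟨h0, h2, h1, h3.symm, h6, h7, h4, h5, h9, h8, ?_⟩
      intro s hs hadj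
      have := h10 s hs hadj
      tauto
    · rintro p v t t' ⟨h0, h1, h2, h3, h4, h5, h6, h7, h8, h9, h10⟩
        ⟨-, -, k2, k3, -, -, k6, k7, -, k9, k10⟩
      rcases h10 t' k2 k9 with e | e | e | e
      exacts [absurd e k6, absurd e k7, absurd e.symm k3, e.symm]
    · rintro p q r v t t' t'' ⟨p0, p1, -, -, -, -, -, -, p8, -, -⟩
        ⟨q0, -, -, -, -, -, -, -, q8, -, -⟩ ⟨r0, -, -, -, -, -, -, -, r8, -, -⟩
      by_contra hn
      push Not at hn
      obtain ⟨v1, v2, v3, v4⟩ := hmatch v p1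
      rcases nbr_cases hcubic p8.symm q8.symm r8.symm v3 hn.1 hn.2.1 hn.2.2 with e | e | e
      exacts [p0 (e ▸ v1), q0 (e ▸ v1), r0 (e ▸ v1)]
    · rintro p v t ⟨h0, h1, h2, h3, -⟩
      exact h3
    · intro v hv
      obtain ⟨v1, v2, v3, v4⟩ := hmatch v (hDS v hv)
      exact ⟨hDm v hv, v2, v4⟩
    · intro a b ha hb hab hab'
      have fa : ∃ q, q ∉ S ∧ G.Adj q u ∧ G.Adj q a ∧ D a ∧ a ≠ u ∧ a ≠ m u := by
        obtain ⟨-, -, -, -, x4, x5, x6, x7, x8, x9, -⟩ := qx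
        obtain ⟨-, -, -, -, y4, y5, y6, y7, y8, y9, -⟩ := qy
        rcases ha with rfl | rfl | rfl | rfl
        · exact ⟨x, x0, xu, x8, ha₁, x4, x5⟩
        · exact ⟨x, x0, xu, x9, ha₂, x6, x7⟩
        · exact ⟨y, y0, yu, y8, ha₃, y4, y5⟩
        · exact ⟨y, y0, yu, y9, ha₄, y6, y7⟩
      have fb : ∃ q, q ∉ S ∧ G.Adj q (m u) ∧ G.Adj q b ∧ D b ∧ b ≠ u ∧ b ≠ m u := by
        obtain ⟨-, -, -, -, z4, z5, z6, z7, z8, z9, -⟩ := qz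
        obtain ⟨-, -, -, -, w4, w5, w6, w7, w8, w9, -⟩ := qw
        rcases hb with rfl | rfl | rfl
        · exact ⟨z, z0, zu, z8, hb₁, z4, z5⟩
        · exact ⟨z, z0, zu, z9, hb₂, z6, z7⟩
        · exact ⟨w, w0, wu, w8, hb₃, w4, w5⟩
      obtain ⟨q₁, h1, h1u, h1a, Da, hau, haub⟩ := fa
      obtain ⟨q₂, h2, h2u, h2b, Db, hbu, hbub⟩ := fb
      exact constraint hdom hmatch hmincard hDS hDm hDp rfl hu hN h1 h2 h1u h2u h1a h2b
        (ne q₁ q₂ h1 h1u h2u) Da Db hau haub hbu hbub hab hab'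
  rcases h.shape.2.2.2.2.2.2.2 with e | e
  · exact core_aux hcubic hmatch hmincard hdom hDS hDp hu h xu yu zu wu e
  · exact core_aux hcubic hmatch hmincard hdom hDS hDp hu h.swapB xu yu zu wu e


/-- Membership in `D` excludes the other classes. -/
theorem setD_excl [DecidableRel G.Adj] (hmatch : IsMatchingOn G S m) {v : V}
    (hv : v ∈ setD G S m) : v ∉ setA G S m ∧ v ∉ setB G S m ∪ setC G S m := by
  simp only [setD, Finset.mem_filter] at hv
  obtain ⟨h0, h1, h2⟩ := hv
  have h3 := (hmatch v h0).2.2.2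
  simp [setA, setB, setC, h1, h2]

theorem card_nbrS_le [DecidableRel G.Adj] (hcubic : ∀ v : V, G.degree v = 3) (x : V) :
    (nbrS G S x).card ≤ 3 := by
  rw [← hcubic x, ← SimpleGraph.card_neighborFinset_eq_degree]
  apply Finset.card_le_card
  intro s hs
  rw [SimpleGraph.mem_neighborFinset]
  exact (Finset.mem_filter.1 hs).2

theorem split_three {T : Finset V} {u : V} (hu : u ∈ T) (hT : T.card = 3) :
    ∃ a b, u ≠ a ∧ u ≠ b ∧ a ≠ b ∧ T = {u, a, b} := by
  have h2 : (T.erase u).card = 2 := by rw [Finset.card_erase_of_mem hu, hT]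
  obtain ⟨a, b, hab, e⟩ := Finset.card_eq_two.1 h2
  have ha : a ∈ T.erase u := by rw [e]; simp
  have hb : b ∈ T.erase u := by rw [e]; simp
  refine ⟨a, b, (Finset.ne_of_mem_erase ha).symm, (Finset.ne_of_mem_erase hb).symm, hab, ?_⟩
  rw [← e, Finset.insert_erase hu]

/-- The shape of the weights at a vertex of `D`. -/
theorem weight_cases [DecidableRel G.Adj] (hcubic : ∀ v : V, G.degree v = 3)
    (hmatch : IsMatchingOn G S m) {x u : V} (hu : u ∈ setD G S m) (hx : x ∉ S)
    (hxu : G.Adj x u) :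
    (fwt G S m x u = 1 / 3 → nbrS G S x ⊆ setD G S m ∧ (nbrS G S x).card = 3) ∧
    (fwt G S m x u = 5 / 12 → (nbrS G S x ∩ setD G S m).card = 2 ∧ (nbrS G S x).card = 3) := by
  have huS : u ∈ S := (Finset.mem_filter.1 hu).1
  have hun : u ∈ nbrS G S x := Finset.mem_filter.2 ⟨huS, hxu⟩
  obtain ⟨nA, nBC⟩ := setD_excl hmatch hu
  have hle := card_nbrS_le (S := S) hcubic x
  have hpos : 0 < (nbrS G S x).card := Finset.card_pos.2 ⟨u, hun⟩
  have hDne : nbrS G S x ∩ setD G S m ≠ ∅ :=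
    Finset.nonempty_iff_ne_empty.1 ⟨u, Finset.mem_inter.2 ⟨hun, hu⟩⟩
  unfold fwt
  rw [if_neg (by tauto)]
  split_ifs with h1 h2
  · constructor <;> intro h <;> norm_num at h
  · have h3 : nbrS G S x ⊆ setD G S m := by
      rcases h2 with h | h | h
      · exact absurd (h hun) nA
      · exact absurd (h hun) nBC
      · exact h
    generalize (nbrS G S x).card = n at *
    refine ⟨fun h => ⟨h3, ?_⟩, fun h => ?_⟩
    all_goals interval_cases n <;> first | rfl | (exfalso; norm_num at h; done)
  · have hdisj : Disjoint (nbrS G S x ∩ (setB G S m ∪ setC G S m)) (nbrS G S x ∩ setD G S m) := by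
      rw [Finset.disjoint_left]
      intro s hs hs'
      exact (setD_excl hmatch (Finset.mem_inter.1 hs').2).2 (Finset.mem_inter.1 hs).2
    have hsum : (nbrS G S x ∩ (setB G S m ∪ setC G S m)).card + (nbrS G S x ∩ setD G S m).card
        ≤ (nbrS G S x).card := by
      rw [← Finset.card_union_of_disjoint hdisj]
      apply Finset.card_le_card
      intro s hs
      rcases Finset.mem_union.1 hs with h | h <;> exact (Finset.mem_inter.1 h).1
    have hd : 0 < (nbrS G S x ∩ setD G S m).card :=
      Finset.card_pos.2 (Finset.nonempty_iff_ne_empty.2 hDne)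
    have hall : (nbrS G S x ∩ setD G S m).card = 3 → nbrS G S x ⊆ setD G S m := by
      intro h
      have e := Finset.eq_of_subset_of_card_le
        (Finset.inter_subset_left : nbrS G S x ∩ setD G S m ⊆ nbrS G S x) (by omega)
      rw [← e]
      exact Finset.inter_subset_right
    have hn3 : (nbrS G S x ∩ setD G S m).card ≠ 3 := fun h => h2 (by right; right; exact hall h)
    clear hall
    generalize (nbrS G S x ∩ (setB G S m ∪ setC G S m)).card = k at *
    generalize (nbrS G S x ∩ setD G S m).card = d at *
    generalize (nbrS G S x).card = n at *
    have hd2 : d ≤ 2 := by omega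
    have hk2 : k ≤ 2 := by omega
    refine ⟨fun h => ?_, fun h => ?_⟩
    all_goals
      interval_cases d <;> interval_cases k <;> norm_num at h <;> omega

theorem third_shape [DecidableRel G.Adj] (hcubic : ∀ v : V, G.degree v = 3)
    (hmatch : IsMatchingOn G S m) {x u : V} (hu : u ∈ setD G S m) (hx : x ∉ S)
    (hxu : G.Adj x u) (h : fwt G S m x u = 1 / 3) :
    ∃ a b, a ∈ setD G S m ∧ b ∈ setD G S m ∧ u ≠ a ∧ u ≠ b ∧ a ≠ b ∧ nbrS G S x = {u, a, b} := by
  obtain ⟨h1, h2⟩ := (weight_cases hcubic hmatch hu hx hxu).1 h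
  have hun : u ∈ nbrS G S x := Finset.mem_filter.2 ⟨(Finset.mem_filter.1 hu).1, hxu⟩
  obtain ⟨a, b, k1, k2, k3, e⟩ := split_three hun h2
  exact ⟨a, b, h1 (by simp [e]), h1 (by simp [e]), k1, k2, k3, e⟩

theorem five_shape [DecidableRel G.Adj] (hcubic : ∀ v : V, G.degree v = 3)
    (hmatch : IsMatchingOn G S m) {x u : V} (hu : u ∈ setD G S m) (hx : x ∉ S)
    (hxu : G.Adj x u) (h : fwt G S m x u = 5 / 12) :
    ∃ a b, a ∈ setD G S m ∧ b ∉ setD G S m ∧ u ≠ a ∧ u ≠ b ∧ a ≠ b ∧ nbrS G S x = {u, a, b} := by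
  obtain ⟨h1, h2⟩ := (weight_cases hcubic hmatch hu hx hxu).2 h
  have hun : u ∈ nbrS G S x := Finset.mem_filter.2 ⟨(Finset.mem_filter.1 hu).1, hxu⟩
  obtain ⟨a, b, k1, k2, k3, e⟩ := split_three hun h2
  by_cases ha : a ∈ setD G S m <;> by_cases hb : b ∈ setD G S m
  · exfalso
    have : nbrS G S x ∩ setD G S m = nbrS G S x := by
      rw [Finset.inter_eq_left, e]
      intro s hs
      simp only [Finset.mem_insert, Finset.mem_singleton] at hs
      rcases hs with rfl | rfl | rfl <;> assumption
    rw [this] at h1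
    omega
  · exact ⟨a, b, ha, hb, k1, k2, k3, e⟩
  · exact ⟨b, a, hb, ha, k2, k1, k3.symm, by rw [e, Finset.pair_comm]⟩
  · exfalso
    have : nbrS G S x ∩ setD G S m ⊆ {u} := by
      intro s hs
      rw [e] at hs
      simp only [Finset.mem_inter, Finset.mem_insert, Finset.mem_singleton] at hs
      rcases hs with ⟨rfl | rfl | rfl, h⟩
      · simp
      · exact absurd h ha
      · exact absurd h hb
    have := Finset.card_le_card this
    simp at this
    omega

theorem four_cases {p q r s : ℚ}
    (h : ({p, q, r, s} : Multiset ℚ) = ({1/3, 1/3, 1/3, 5/12} : Multiset ℚ)) :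
    (p = 5/12 ∧ q = 1/3 ∧ r = 1/3 ∧ s = 1/3) ∨ (p = 1/3 ∧ q = 5/12 ∧ r = 1/3 ∧ s = 1/3) ∨
    (p = 1/3 ∧ q = 1/3 ∧ r = 5/12 ∧ s = 1/3) ∨ (p = 1/3 ∧ q = 1/3 ∧ r = 1/3 ∧ s = 5/12) := by
  have hm : ∀ t ∈ ({p, q, r, s} : Multiset ℚ), t = 1/3 ∨ t = 5/12 := by
    intro t ht
    rw [h] at ht
    simp only [Multiset.insert_eq_cons, Multiset.mem_cons, Multiset.mem_singleton] at ht
    tauto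
  have hs := congrArg Multiset.sum h
  simp only [Multiset.insert_eq_cons, Multiset.sum_cons, Multiset.sum_singleton] at hs
  rcases hm p (by simp) with e1 | e1 <;> rcases hm q (by simp) with e2 | e2 <;>
  rcases hm r (by simp) with e3 | e3 <;> rcases hm s (by simp) with e4 | e4 <;>
  subst e1 e2 e3 e4 <;> first | (exfalso; norm_num at hs; done) | norm_num

end graphPart

theorem solo_D_pair_not_three_thirds_one_five_twelfths {V : Type*} [Fintype V] [DecidableEq V]
    (G : SimpleGraph V) [DecidableRel G.Adj] (S : Finset V) (m : V → V)
    (hconn : G.Connected)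
    (hcubic : ∀ v : V, G.degree v = 3)
    (hdom : ∀ v : V, v ∉ S → ∃ u ∈ S, G.Adj v u)
    (hmatch : IsMatchingOn G S m)
    (hmincard : ∀ T : Finset V, IsPDS G T → S.card ≤ T.card)
    (hP1 : ∀ T : Finset V, IsPDS G T → T.card = S.card → lambdaS G S ≤ lambdaS G T)
    (hP2 : ∀ (T : Finset V) (m' : V → V),
        (∀ v : V, v ∉ T → ∃ u ∈ T, G.Adj v u) → IsMatchingOn G T m' →
        T.card = S.card → lambdaS G T = lambdaS G S →
        (setA G S m ∪ setB G S m).card ≤ (setA G T m' ∪ setB G T m').card) :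
    ∀ u : V, u ∈ setD G S m → IsSoloPair G S m u →
      (¬ ∃ x : V, x ∉ S ∧ G.Adj u x ∧ G.Adj (m u) x) →
      ¬ ∃ x y z w : V, x ∉ S ∧ y ∉ S ∧ z ∉ S ∧ w ∉ S ∧
        x ≠ y ∧ z ≠ w ∧
        G.Adj x u ∧ G.Adj y u ∧ G.Adj z (m u) ∧ G.Adj w (m u) ∧
        ({fwt G S m x u, fwt G S m y u, fwt G S m z (m u), fwt G S m w (m u)} : Multiset ℚ)
          = ({1/3, 1/3, 1/3, 5/12} : Multiset ℚ) := by
  rintro u hu - hcom ⟨x, y, z, w, x0, y0, z0, w0, hxy, hzw, xu, yu, zu, wu, hf⟩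
  have hDS : ∀ v, v ∈ setD G S m → v ∈ S := fun v hv => (Finset.mem_filter.1 hv).1
  have hDm : ∀ v, v ∈ setD G S m → m v ∈ setD G S m := by
    intro v hv
    obtain ⟨h0, h1, h2⟩ := Finset.mem_filter.1 hv
    obtain ⟨k1, k2, k3, k4⟩ := hmatch v h0
    exact Finset.mem_filter.2 ⟨k1, h2, by rw [k4]; exact h1⟩
  have hDp : ∀ v p, v ∈ setD G S m → p ∉ S → G.Adj p v → ∃ s ∈ S, s ≠ v ∧ G.Adj p s := by
    intro v p hv hp hadj
    obtain ⟨h0, h1, h2⟩ := Finset.mem_filter.1 hv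
    by_contra hn
    push Not at hn
    have : p ∈ privates G S v := by
      refine Finset.mem_filter.2 ⟨Finset.mem_univ _, hp, ?_⟩
      ext s
      simp only [nbrS, Finset.mem_filter, Finset.mem_singleton]
      constructor
      · rintro ⟨hs, hs'⟩
        by_contra hne
        exact hn s hs hne hs'
      · rintro rfl
        exact ⟨h0, hadj⟩
    rw [h1] at this
    simp at this
  have hmm := (hmatch u (hDS u hu)).2.2.2
  have hmu := hDm u hu
  have hcom' : ¬ ∃ x : V, x ∉ S ∧ G.Adj (m u) x ∧ G.Adj (m (m u)) x := by
    rw [hmm]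
    rintro ⟨q, h1, h2, h3⟩
    exact hcom ⟨q, h1, h3, h2⟩
  have T := fun {x u : V} => third_shape (x := x) (u := u) hcubic hmatch
  have F := fun {x u : V} => five_shape (x := x) (u := u) hcubic hmatch
  have C := fun {u x y z w : V} => core (u := u) (x := x) (y := y) (z := z) (w := w)
    hcubic hdom hmatch hmincard hDS hDm hDp
  rcases four_cases hf with ⟨e1, e2, e3, e4⟩ | ⟨e1, e2, e3, e4⟩ | ⟨e1, e2, e3, e4⟩ |
    ⟨e1, e2, e3, e4⟩
  · exact C hmu hcom' z0 w0 y0 x0 hzw hxy.symm zu wu (by rwa [hmm]) (by rwa [hmm])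
      (T hmu z0 zu e3) (T hmu w0 wu e4) (by rw [hmm]; exact T hu y0 yu e2)
      (by rw [hmm]; exact F hu x0 xu e1)
  · exact C hmu hcom' z0 w0 x0 y0 hzw hxy zu wu (by rwa [hmm]) (by rwa [hmm])
      (T hmu z0 zu e3) (T hmu w0 wu e4) (by rw [hmm]; exact T hu x0 xu e1)
      (by rw [hmm]; exact F hu y0 yu e2)
  · exact C hu hcom x0 y0 w0 z0 hxy hzw.symm xu yu wu zu
      (T hu x0 xu e1) (T hu y0 yu e2) (T hmu w0 wu e4) (F hmu z0 zu e3)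
  · exact C hu hcom x0 y0 z0 w0 hxy hzw xu yu zu wu
      (T hu x0 xu e1) (T hu y0 yu e2) (T hmu z0 zu e3) (F hmu w0 wu e4)
end
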